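/- arXiv:math/0309252 — 3 statements merged into one kernel-verified Lean document; each statement's English description precedes it below -/
import Mathlib

section
/- Let n ≥ 1 be an integer, let p ∈ ℂ with 0 < |p| < 1, and let t_0, ..., t_{n+1}, z_1, ..., z_n ∈ ℂ, all nonzero, with θ(z_i z_j;p) ≠ 0 for all 1 ≤ i ≤ j ≤ n and θ(z_i/z_j;p) ≠ 0 for all i < j. Then Σ_{σ ∈ {±1}^n} θ( (∏_{r=0}^{n+1} t_r) / ∏_{i=1}^{n} z_i^{σ_i} ; p) · ∏_{i=1}^{n} ∏_{r=0}^{n+1} θ(t_r z_i^{σ_i};p) / ∏_{1≤i≤j≤n} θ(z_i^{σ_i} z_j^{σ_j};p) = ∏_{0≤r<s≤n+1} θ(t_r t_s;p). (Note the denominator includes the i = j terms θ(z_i^{2σ_i};p).) -/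
open scoped BigOperators Real

/-- The theta function `θ(x;p)`. -/
noncomputable def ellTheta (x p : ℂ) : ℂ :=
  ∏' k : ℕ, ((1 - p ^ k * x) * (1 - p ^ (k + 1) / x))

/-- `z^{σ}`: `z` if the sign is `+1` (`true`), `z⁻¹` if the sign is `−1` (`false`). -/
noncomputable def pw (z : ℂ) (b : Bool) : ℂ := if b then z else z⁻¹

/-- The infinite product `∏_{k ≥ 0} (1 - p ^ k x)`. -/
noncomputable def qProd (x p : ℂ) : ℂ := ∏' k : ℕ, (1 - p ^ k * x)

section Theta

variable {p : ℂ}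

lemma summable_norm_pow_mul (hp1 : ‖p‖ < 1) (x : ℂ) : Summable fun k : ℕ => ‖-(p ^ k * x)‖ := by
  simpa using (summable_geometric_of_lt_one (norm_nonneg _) hp1).mul_right ‖x‖

lemma multipliable_qProd (hp1 : ‖p‖ < 1) (x : ℂ) :
    Multipliable fun k : ℕ => 1 - p ^ k * x := by
  simpa [sub_eq_add_neg] using multipliable_one_add_of_summable (summable_norm_pow_mul hp1 x)

lemma qProd_eq_mul (hp1 : ‖p‖ < 1) (x : ℂ) : qProd x p = (1 - x) * qProd (p * x) p := by
  have h : Multipliable fun k : ℕ => 1 - p ^ (k + 1) * x := by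
    simpa [pow_succ, mul_assoc] using multipliable_qProd hp1 (p * x)
  have h' := tprod_eq_zero_mul' (f := fun k : ℕ => 1 - p ^ k * x) h
  simp only [pow_zero, one_mul] at h'
  simp only [qProd, h', ← mul_assoc, pow_succ]

lemma exists_of_qProd_eq_zero (hp1 : ‖p‖ < 1) {x : ℂ} (h : qProd x p = 0) :
    ∃ k : ℕ, p ^ k * x = 1 := by
  by_contra! hne
  refine tprod_one_add_ne_zero_of_summable (f := fun k : ℕ => -(p ^ k * x)) (fun k => ?_)
    (summable_norm_pow_mul hp1 x) (by simpa [qProd, sub_eq_add_neg] using h)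
  rw [← sub_eq_add_neg, sub_ne_zero]
  exact (hne k).symm

lemma differentiable_qProd (hp1 : ‖p‖ < 1) : Differentiable ℂ fun x => qProd x p := by
  intro x
  have hprod : HasProdLocallyUniformlyOn (fun (k : ℕ) (y : ℂ) => 1 + -(p ^ k * y))
      (fun y => ∏' k : ℕ, (1 + -(p ^ k * y))) (Metric.ball 0 (‖x‖ + 1)) := by
    refine Summable.hasProdLocallyUniformlyOn_nat_one_add Metric.isOpen_ball
      ((summable_geometric_of_lt_one (norm_nonneg _) hp1).mul_right (‖x‖ + 1))
      (.of_forall fun k y hy => ?_) (fun k => by fun_prop)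
    rw [norm_neg, norm_mul, norm_pow]
    exact mul_le_mul_of_nonneg_left (by simpa using (mem_ball_zero_iff.1 hy).le) (by positivity)
  have hd := hprod.differentiableOn
    (.of_forall fun _ ↦ by simpa [Finset.prod_fn] using
      DifferentiableOn.finsetProd (fun _ _ ↦ by fun_prop)) Metric.isOpen_ball
  refine (hd.congr fun y _ => by simp [qProd, sub_eq_add_neg]).differentiableAt
    (Metric.isOpen_ball.mem_nhds ?_)
  simp

lemma ellTheta_eq_qProd_mul (hp1 : ‖p‖ < 1) (x : ℂ) :
    ellTheta x p = qProd x p * qProd (p / x) p := by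
  rw [qProd, qProd, ← (multipliable_qProd hp1 x).tprod_mul (multipliable_qProd hp1 (p / x))]
  simp only [ellTheta, pow_succ, mul_div_assoc]

lemma ellTheta_eq_one_sub_mul (hp1 : ‖p‖ < 1) (x : ℂ) :
    ellTheta x p = (1 - x) * (qProd (p * x) p * qProd (p / x) p) := by
  rw [ellTheta_eq_qProd_mul hp1, qProd_eq_mul hp1, mul_assoc]

lemma ellTheta_one (hp1 : ‖p‖ < 1) : ellTheta 1 p = 0 := by
  simp [ellTheta_eq_one_sub_mul hp1]

lemma ellTheta_inv (hp1 : ‖p‖ < 1) {x : ℂ} (hx : x ≠ 0) :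
    ellTheta x⁻¹ p = -(ellTheta x p / x) := by
  rw [ellTheta_eq_one_sub_mul hp1, ellTheta_eq_one_sub_mul hp1, div_inv_eq_mul,
    ← div_eq_mul_inv]
  field_simp
  ring

lemma ellTheta_mul_left (hp0 : p ≠ 0) (hp1 : ‖p‖ < 1) {x : ℂ} (hx : x ≠ 0) :
    ellTheta (p * x) p = -(ellTheta x p / x) := by
  rw [← ellTheta_inv hp1 hx, ellTheta_eq_qProd_mul hp1, ellTheta_eq_qProd_mul hp1,
    div_inv_eq_mul, mul_comm, show p / (p * x) = x⁻¹ by field_simp]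

lemma ellTheta_mul_left_eq_zero_iff (hp0 : p ≠ 0) (hp1 : ‖p‖ < 1) {x : ℂ} (hx : x ≠ 0) :
    ellTheta (p * x) p = 0 ↔ ellTheta x p = 0 := by
  simp [ellTheta_mul_left hp0 hp1 hx, hx]

lemma exists_zpow_of_ellTheta_eq_zero (hp0 : p ≠ 0) (hp1 : ‖p‖ < 1) {x : ℂ} (hx : x ≠ 0)
    (h : ellTheta x p = 0) : ∃ k : ℤ, x = p ^ k := by
  rw [ellTheta_eq_qProd_mul hp1, mul_eq_zero] at h
  rcases h with h | h
  · obtain ⟨k, hk⟩ := exists_of_qProd_eq_zero hp1 h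
    refine ⟨-k, ?_⟩
    rw [zpow_neg, zpow_natCast]
    exact eq_inv_of_mul_eq_one_right hk
  · obtain ⟨k, hk⟩ := exists_of_qProd_eq_zero hp1 h
    refine ⟨k + 1, ?_⟩
    rw [zpow_add_one₀ hp0, zpow_natCast]
    field_simp at hk
    exact hk.symm

lemma differentiableAt_ellTheta (hp1 : ‖p‖ < 1) {x : ℂ} (hx : x ≠ 0) :
    DifferentiableAt ℂ (fun y => ellTheta y p) x := by
  simp only [ellTheta_eq_qProd_mul hp1]
  have h := differentiable_qProd hp1
  exact (h x).mul ((h (p / x)).comp (f := fun y => p / y) x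
    ((differentiableAt_const p).div differentiableAt_id hx))

lemma deriv_ellTheta_one_ne_zero (hp1 : ‖p‖ < 1) :
    deriv (fun y => ellTheta y p) 1 ≠ 0 := by
  have h := differentiable_qProd hp1
  have hd : DifferentiableAt ℂ (fun y => qProd (p * y) p * qProd (p / y) p) 1 :=
    ((h (p * 1)).comp (f := fun y => p * y) 1 (by fun_prop)).mul
      ((h (p / 1)).comp (f := fun y => p / y) 1
        ((differentiableAt_const p).div differentiableAt_id one_ne_zero))
  have hder := (((hasDerivAt_id (1 : ℂ)).const_sub 1).mul hd.hasDerivAt).deriv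
  have hq : qProd p p ≠ 0 := by
    intro h0
    obtain ⟨k, hk⟩ := exists_of_qProd_eq_zero hp1 h0
    rw [← pow_succ] at hk
    have := pow_lt_one₀ (norm_nonneg p) hp1 (Nat.succ_ne_zero k)
    rw [← norm_pow, hk, norm_one] at this
    exact lt_irrefl _ this
  have heq : (fun y => ellTheta y p) =
      (fun y => 1 - id y) * fun y => qProd (p * y) p * qProd (p / y) p := by
    funext y
    exact ellTheta_eq_one_sub_mul hp1 y
  rw [heq, hder]
  simp [hq]

lemma deriv_ellTheta_mul_left_eq_zero_iff (hp0 : p ≠ 0) (hp1 : ‖p‖ < 1) {x : ℂ} (hx : x ≠ 0)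
    (h : ellTheta x p = 0) :
    deriv (fun y => ellTheta y p) (p * x) = 0 ↔ deriv (fun y => ellTheta y p) x = 0 := by
  have h1 := (differentiableAt_ellTheta hp1 (mul_ne_zero hp0 hx)).hasDerivAt
  have h2 := h1.comp x ((hasDerivAt_id x).const_mul p)
  have h3 := ((differentiableAt_ellTheta hp1 hx).hasDerivAt.div (hasDerivAt_id x) hx).neg
  have h4 := h3.congr_of_eventuallyEq (f₁ := (fun y => ellTheta y p) ∘ fun y => p * id y) (by
    filter_upwards [isOpen_ne.mem_nhds hx] with y hy
    simpa using ellTheta_mul_left hp0 hp1 hy)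
  have h5 := h2.unique h4
  simp only [h, id, mul_one, sub_zero] at h5
  constructor
  · intro h6
    rw [h6] at h5
    have := h5.symm
    simpa [hx] using this
  · intro h6
    rw [h6] at h5
    simpa [hp0] using h5

lemma deriv_ellTheta_ne_zero (hp0 : p ≠ 0) (hp1 : ‖p‖ < 1) {x : ℂ} (hx : x ≠ 0)
    (h : ellTheta x p = 0) : deriv (fun y => ellTheta y p) x ≠ 0 := by
  obtain ⟨k, rfl⟩ := exists_zpow_of_ellTheta_eq_zero hp0 hp1 hx h
  suffices H : ∀ k : ℤ, ellTheta (p ^ k) p = 0 ∧ deriv (fun y => ellTheta y p) (p ^ k) ≠ 0 from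
    (H k).2
  have hstep (k : ℤ) : p ^ (k + 1) = p * p ^ k := by rw [zpow_add_one₀ hp0, mul_comm]
  intro k
  induction k using Int.induction_on with
  | zero => simpa [ellTheta_one hp1] using deriv_ellTheta_one_ne_zero hp1
  | succ k ih =>
    have hk := zpow_ne_zero (k : ℤ) hp0
    rw [hstep]
    exact ⟨(ellTheta_mul_left_eq_zero_iff hp0 hp1 hk).2 ih.1,
      (deriv_ellTheta_mul_left_eq_zero_iff hp0 hp1 hk ih.1).not.2 ih.2⟩
  | pred k ih =>
    have hk := zpow_ne_zero (-(k : ℤ) - 1) hp0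
    rw [show -(k : ℤ) = (-(k : ℤ) - 1) + 1 by ring, hstep] at ih
    have h0 := (ellTheta_mul_left_eq_zero_iff hp0 hp1 hk).1 ih.1
    exact ⟨h0, (deriv_ellTheta_mul_left_eq_zero_iff hp0 hp1 hk h0).not.1 ih.2⟩

end Theta

lemma exists_eq_mul_of_simple_zeros {U : Set ℂ} (hU : IsOpen U) {f g : ℂ → ℂ}
    (hf : DifferentiableOn ℂ f U) (hg : DifferentiableOn ℂ g U)
    (h : ∀ b ∈ U, g b = 0 → f b = 0 ∧ deriv g b ≠ 0) :
    ∃ q : ℂ → ℂ, DifferentiableOn ℂ q U ∧ ∀ x ∈ U, f x = q x * g x := by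
  refine ⟨fun x => if g x = 0 then deriv f x / deriv g x else f x / g x, fun b hb => ?_,
    fun x hx => ?_⟩
  · refine DifferentiableAt.differentiableWithinAt ?_
    have hUb := hU.mem_nhds hb
    have hfb := hf.differentiableAt hUb
    have hgb := hg.differentiableAt hUb
    by_cases h0 : g b = 0
    · obtain ⟨hfz, hg'⟩ := h b hb h0
      have hdf := ((Complex.differentiableOn_dslope hUb).2 hf).differentiableAt hUb
      have hdg := ((Complex.differentiableOn_dslope hUb).2 hg).differentiableAt hUb
      refine (hdf.div hdg (by rwa [dslope_same])).congr_of_eventuallyEq ?_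
      have hne := eventually_nhdsWithin_iff.1 (hgb.hasDerivAt.eventually_ne (c := 0) hg')
      filter_upwards [hne] with x hx
      by_cases hxb : x = b
      · subst hxb
        simp [h0, dslope_same]
      · have hgx := hx hxb
        have hsub := sub_ne_zero.2 hxb
        simp only [hgx, if_false, Pi.div_apply, dslope_of_ne _ hxb, slope_def_field, hfz, h0,
          sub_zero]
        field_simp
    · refine (hfb.div hgb h0).congr_of_eventuallyEq ?_
      filter_upwards [hgb.continuousAt.eventually_ne h0] with x hx
      simp [hx]
  · by_cases h0 : g x = 0
    · simp [h0, (h x hx h0).1]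
    · simp [h0]

lemma eqOn_of_mul_eq_mul_of_simple_zeros {U : Set ℂ} (hU : IsOpen U) {q r g : ℂ → ℂ}
    (hq : ContinuousOn q U) (hr : ContinuousOn r U) (hg : DifferentiableOn ℂ g U)
    (h : ∀ b ∈ U, g b = 0 → deriv g b ≠ 0) (heq : ∀ x ∈ U, q x * g x = r x * g x) :
    Set.EqOn q r U := by
  intro b hb
  by_cases h0 : g b = 0
  · have hUb := hU.mem_nhds hb
    have hne := (hg.differentiableAt hUb).hasDerivAt.eventually_ne (c := 0) (h b hb h0)
    refine (((hq.continuousAt hUb).eventuallyEq_nhds_iff_eventuallyEq_nhdsNE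
      (hr.continuousAt hUb)).1 ?_).eq_of_nhds
    filter_upwards [hne, nhdsWithin_le_nhds hUb] with x hx hxU
    exact mul_right_cancel₀ hx (heq x hxU)
  · exact mul_right_cancel₀ h0 (heq b hb)

section Quasiperiodic

variable {p : ℂ}

lemma exists_zpow_mul_mem_annulus (hp0 : p ≠ 0) (hp1 : ‖p‖ < 1) {x : ℂ} (hx : x ≠ 0) :
    ∃ k : ℤ, ‖p‖ ≤ ‖p ^ k * x‖ ∧ ‖p ^ k * x‖ ≤ 1 := by
  have hp : 0 < ‖p‖ := norm_pos_iff.2 hp0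
  obtain ⟨k, hk1, hk2⟩ := exists_mem_Ico_zpow (norm_pos_iff.2 hx) (one_lt_inv₀ hp |>.2 hp1)
  refine ⟨k + 1, ?_, ?_⟩
  · rw [norm_mul, norm_zpow, zpow_add_one₀ hp.ne']
    rw [inv_zpow, inv_le_iff_one_le_mul₀ (by positivity)] at hk1
    nlinarith
  · rw [norm_mul, norm_zpow]
    rw [inv_zpow, lt_inv_comm₀ (by positivity) (by positivity)] at hk2
    have := mul_le_mul_of_nonneg_right hk2.le (norm_nonneg x)
    rwa [inv_mul_cancel₀ (norm_ne_zero_iff.2 hx)] at this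

/-- A holomorphic function on the punctured plane which is multiplied by a constant under
`x ↦ p x` and has a zero vanishes identically. -/
lemma eq_zero_of_mul_left_eq_const_mul (hp0 : p ≠ 0) (hp1 : ‖p‖ < 1) {f : ℂ → ℂ}
    (hf : DifferentiableOn ℂ f {0}ᶜ) {C : ℂ} (hC : C ≠ 0)
    (hq : ∀ x, x ≠ 0 → f (p * x) = C * f x) {a : ℂ} (ha : a ≠ 0) (hfa : f a = 0)
    {x : ℂ} (hx : x ≠ 0) : f x = 0 := by
  have hp : 0 < ‖p‖ := norm_pos_iff.2 hp0
  set s : ℝ := -Real.log ‖C‖ / Real.log ‖p‖ with hs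
  have hlog : Real.log ‖p‖ ≠ 0 := (Real.log_neg hp hp1).ne
  have hCs : ‖C‖ * ‖p‖ ^ s = 1 := by
    rw [Real.rpow_def_of_pos hp, hs, mul_div_cancel₀ _ hlog, Real.exp_neg,
      Real.exp_log (norm_pos_iff.2 hC), mul_inv_cancel₀ (norm_ne_zero_iff.2 hC)]
  set H : ℂ → ℝ := fun x => ‖f x‖ * ‖x‖ ^ s with hH
  have hHp : ∀ x, x ≠ 0 → H (p * x) = H x := by
    intro x hx
    simp only [hH]
    rw [hq x hx, norm_mul, norm_mul, Real.mul_rpow (norm_nonneg _) (norm_nonneg _)]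
    linear_combination ‖f x‖ * ‖x‖ ^ s * hCs
  have hHk : ∀ k : ℤ, ∀ x, x ≠ 0 → H (p ^ k * x) = H x := by
    intro k x hx
    induction k using Int.induction_on with
    | zero => simp
    | succ k ih =>
      rw [zpow_add_one₀ hp0, mul_comm _ p, mul_assoc,
        hHp _ (mul_ne_zero (zpow_ne_zero _ hp0) hx), ih]
    | pred k ih =>
      rw [← ih, ← hHp _ (mul_ne_zero (zpow_ne_zero _ hp0) hx), ← mul_assoc, ← zpow_one_add₀ hp0,
        add_sub_cancel]
  set K : Set ℂ := {x | ‖p‖ ≤ ‖x‖ ∧ ‖x‖ ≤ 1} with hK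
  have hK0 : ∀ x ∈ K, x ≠ 0 := fun x hx => norm_pos_iff.1 (hp.trans_le hx.1)
  have hKc : IsCompact K := by
    refine Metric.isCompact_of_isClosed_isBounded ?_ ?_
    · exact (isClosed_le continuous_const continuous_norm).inter
        (isClosed_le continuous_norm continuous_const)
    · exact Metric.isBounded_closedBall.subset fun x hx => mem_closedBall_zero_iff.2 hx.2
  have hHc : ContinuousOn H K :=
    ((hf.continuousOn.mono hK0).norm).mul
      (continuous_norm.continuousOn.rpow_const fun x hx => Or.inl (norm_ne_zero_iff.2 (hK0 x hx)))
  obtain ⟨M, hM⟩ := hKc.exists_bound_of_continuousOn hHc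
  have hHM : ∀ x, x ≠ 0 → H x ≤ M := by
    intro x hx
    obtain ⟨k, hk⟩ := exists_zpow_mul_mem_annulus hp0 hp1 hx
    rw [← hHk k x hx]
    exact (le_abs_self _).trans (hM _ hk)
  set G : ℂ → ℂ := fun u => f (Complex.exp u) * Complex.exp (s * u) with hG
  have hGn : ∀ u, ‖G u‖ = H (Complex.exp u) := by
    intro u
    simp only [hG, hH, norm_mul, Complex.norm_exp, ← Real.exp_mul]
    simp [mul_comm]
  have hGd : Differentiable ℂ G := by
    intro u
    refine DifferentiableAt.mul ?_ (by fun_prop)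
    exact (hf.differentiableAt (isOpen_compl_singleton.mem_nhds (Complex.exp_ne_zero u))).comp u
      Complex.differentiable_exp.differentiableAt
  have hGb : Bornology.IsBounded (Set.range G) := by
    refine (isBounded_iff_forall_norm_le).2 ⟨M, ?_⟩
    rintro _ ⟨u, rfl⟩
    rw [hGn]
    exact hHM _ (Complex.exp_ne_zero u)
  have h := hGd.apply_eq_apply_of_bounded hGb (Complex.log x) (Complex.log a)
  simp only [hG, Complex.exp_log hx, Complex.exp_log ha, hfa, zero_mul] at h
  exact (mul_eq_zero.1 h).resolve_right (Complex.exp_ne_zero _)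

lemma eq_zero_of_zpow_mul (hp0 : p ≠ 0) {f : ℂ → ℂ} {C : ℂ} (hC : C ≠ 0) {m : ℕ}
    (hq : ∀ x, x ≠ 0 → x ^ m * f (p * x) = C * f x) {a : ℂ} (ha : a ≠ 0) (hfa : f a = 0)
    (k : ℤ) : f (p ^ k * a) = 0 := by
  have hstep (x : ℂ) (hx : x ≠ 0) : f (p * x) = 0 ↔ f x = 0 := by
    have h := hq x hx
    constructor <;> intro h0
    · simpa [h0, hC] using h.symm
    · simpa [h0, hx] using h
  induction k using Int.induction_on with
  | zero => simpa using hfa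
  | succ k ih =>
    rw [zpow_add_one₀ hp0, mul_comm _ p, mul_assoc]
    exact (hstep _ (mul_ne_zero (zpow_ne_zero _ hp0) ha)).2 ih
  | pred k ih =>
    refine (hstep _ (mul_ne_zero (zpow_ne_zero _ hp0) ha)).1 ?_
    rwa [← mul_assoc, ← zpow_one_add₀ hp0, add_sub_cancel]

lemma eq_zero_of_ellTheta_div_eq_zero (hp0 : p ≠ 0) (hp1 : ‖p‖ < 1) {f : ℂ → ℂ} {C : ℂ}
    (hC : C ≠ 0) {m : ℕ} (hq : ∀ x, x ≠ 0 → x ^ m * f (p * x) = C * f x) {a x : ℂ} (ha : a ≠ 0)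
    (hfa : f a = 0) (hx : x ≠ 0) (h : ellTheta (x / a) p = 0) : f x = 0 := by
  obtain ⟨k, hk⟩ := exists_zpow_of_ellTheta_eq_zero hp0 hp1 (div_ne_zero hx ha) h
  rw [(div_eq_iff ha).1 hk]
  exact eq_zero_of_zpow_mul hp0 hC hq ha hfa k

/-- A theta function of degree `m` with more than `m` zeros modulo `p ^ ℤ` vanishes. -/
theorem eq_zero_of_card_lt {ι : Type*} [DecidableEq ι] (hp0 : p ≠ 0) (hp1 : ‖p‖ < 1) {m : ℕ}
    {s : Finset ι} {a : ι → ℂ} (ha : ∀ i ∈ s, a i ≠ 0)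
    (hne : ∀ i ∈ s, ∀ j ∈ s, i ≠ j → ellTheta (a i / a j) p ≠ 0) (hcard : m < s.card)
    {f : ℂ → ℂ} (hf : DifferentiableOn ℂ f {0}ᶜ) {C : ℂ} (hC : C ≠ 0)
    (hq : ∀ x, x ≠ 0 → x ^ m * f (p * x) = C * f x) (hfa : ∀ i ∈ s, f (a i) = 0)
    {x : ℂ} (hx : x ≠ 0) : f x = 0 := by
  obtain ⟨i, hi⟩ := Finset.card_pos.1 (Nat.zero_lt_of_lt hcard)
  have hai := ha i hi
  induction m generalizing s C f i x with
  | zero =>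
    exact eq_zero_of_mul_left_eq_const_mul hp0 hp1 hf hC (by simpa using hq) hai (hfa i hi) hx
  | succ m ih =>
    have hda {x : ℂ} (hx : x ≠ 0) : HasDerivAt (fun y => ellTheta (y / a i) p)
        (deriv (fun y => ellTheta y p) (x / a i) * (1 / a i)) x :=
      (differentiableAt_ellTheta hp1 (div_ne_zero hx hai)).hasDerivAt.comp
        (h := fun y => y / a i) x ((hasDerivAt_id x).div_const (a i))
    have hg : DifferentiableOn ℂ (fun y => ellTheta (y / a i) p) {0}ᶜ := fun x hx =>
      (hda hx).differentiableAt.differentiableWithinAt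
    have hsimple : ∀ b ∈ ({0}ᶜ : Set ℂ), ellTheta (b / a i) p = 0 →
        deriv (fun y => ellTheta (y / a i) p) b ≠ 0 := by
      intro b hb h0
      rw [(hda hb).deriv]
      exact mul_ne_zero (deriv_ellTheta_ne_zero hp0 hp1 (div_ne_zero hb hai) h0)
        (one_div_ne_zero hai)
    obtain ⟨q, hqd, hfq⟩ := exists_eq_mul_of_simple_zeros isOpen_compl_singleton hf hg
      fun b hb h0 =>
        ⟨eq_zero_of_ellTheta_div_eq_zero hp0 hp1 hC hq hai (hfa i hi) hb h0, hsimple b hb h0⟩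
    have hcard' : m < (s.erase i).card := by
      rw [Finset.card_erase_of_mem hi]
      omega
    have hq' : Set.EqOn (fun x => x ^ m * q (p * x)) (fun x => -(C / a i) * q x) {0}ᶜ := by
      refine eqOn_of_mul_eq_mul_of_simple_zeros isOpen_compl_singleton ?_ ?_ hg hsimple ?_
      · refine (continuous_id.pow m).continuousOn.mul
          (hqd.continuousOn.comp (by fun_prop) fun x hx => mul_ne_zero hp0 hx)
      · exact continuousOn_const.mul hqd.continuousOn
      · intro x hx
        have hx0 : x ≠ 0 := hx
        have h := hq x hx
        rw [hfq x hx, hfq (p * x) (mul_ne_zero hp0 hx), mul_div_assoc,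
          ellTheta_mul_left hp0 hp1 (div_ne_zero hx hai)] at h
        field_simp at h ⊢
        refine mul_left_cancel₀ hx0 ?_
        linear_combination -h
    obtain ⟨j, hj⟩ := Finset.card_pos.1 (Nat.zero_lt_of_lt hcard')
    rw [hfq x hx, ih (fun k hk => ha k (Finset.mem_of_mem_erase hk))
      (fun k hk l hl => hne k (Finset.mem_of_mem_erase hk) l (Finset.mem_of_mem_erase hl)) hcard'
      hqd (neg_ne_zero.2 (div_ne_zero hC hai)) hq' (fun k hk => ?_) hx j hj
      (ha j (Finset.mem_of_mem_erase hj)), zero_mul]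
    have hks := Finset.mem_of_mem_erase hk
    have h := hfq (a k) (ha k hks)
    rw [hfa k hks] at h
    exact (mul_eq_zero.1 h.symm).resolve_right (hne k hks i hi (Finset.ne_of_mem_erase hk))

end Quasiperiodic

section TypeI

variable {p : ℂ}

lemma pw_ne_zero {z : ℂ} (hz : z ≠ 0) (b : Bool) : pw z b ≠ 0 := by
  cases b <;> simp [pw, hz]

lemma pw_not (z : ℂ) (b : Bool) : pw z (!b) = (pw z b)⁻¹ := by
  cases b <;> simp [pw]

/-- The denominator `∏_{i ≤ j} θ(w_i w_j)`. -/
noncomputable def thetaDenom (p : ℂ) {n : ℕ} (w : Fin n → ℂ) : ℂ :=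
  ∏ i, ∏ j, if i ≤ j then ellTheta (w i * w j) p else 1

/-- The summand of the type I sum, as a function of `w_i = z_i ^ σ_i`. -/
noncomputable def typeITerm (p : ℂ) {m n : ℕ} (t : Fin m → ℂ) (w : Fin n → ℂ) : ℂ :=
  ellTheta ((∏ r, t r) / ∏ i, w i) p * (∏ i, ∏ r, ellTheta (t r * w i) p) / thetaDenom p w

/-- The type I sum over all sign choices. -/
noncomputable def typeISum (p : ℂ) {m n : ℕ} (t : Fin m → ℂ) (z : Fin n → ℂ) : ℂ :=
  ∑ σ : Fin n → Bool, typeITerm p t fun i => pw (z i) (σ i)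

/-- The product `∏_{r < s} θ(t_r t_s)`. -/
noncomputable def typeIProd (p : ℂ) {m : ℕ} (t : Fin m → ℂ) : ℂ :=
  ∏ r, ∏ s, if r < s then ellTheta (t r * t s) p else 1

/-- No denominator occurring in the type I sum vanishes. -/
def ThetaGeneric (p : ℂ) {n : ℕ} (z : Fin n → ℂ) : Prop :=
  ∀ i j a b, (i = j → a = b) → ellTheta (pw (z i) a * pw (z j) b) p ≠ 0

lemma thetaDenom_succAbove {n : ℕ} (w : Fin (n + 1) → ℂ) (k : Fin (n + 1)) :
    thetaDenom p w = ellTheta (w k * w k) p * (∏ i, ellTheta (w k * w (k.succAbove i)) p) *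
      thetaDenom p fun i => w (k.succAbove i) := by
  have hcross (i : Fin n) : (if k ≤ k.succAbove i then ellTheta (w k * w (k.succAbove i)) p else 1) *
      (if k.succAbove i ≤ k then ellTheta (w (k.succAbove i) * w k) p else 1) =
      ellTheta (w k * w (k.succAbove i)) p := by
    rcases lt_or_gt_of_ne (Fin.succAbove_ne k i) with h | h
    · simp [h.le, h.not_ge, mul_comm]
    · simp [h.le, h.not_ge]
  simp only [thetaDenom, Fin.prod_univ_succAbove _ k, le_refl, if_true,
    Fin.succAbove_le_succAbove_iff, Finset.prod_mul_distrib]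
  rw [← Finset.prod_congr rfl fun i _ => hcross i, Finset.prod_mul_distrib]
  ring

lemma typeITerm_cons_eq_zero (hp1 : ‖p‖ < 1) {m n : ℕ} (t : Fin m → ℂ) {w : Fin n → ℂ} {k : Fin n}
    {x : ℂ} (h : x * w k = 1) : typeITerm p (Fin.cons x t) w = 0 := by
  have h0 : ∏ i, ∏ r, ellTheta ((Fin.cons x t : Fin (m + 1) → ℂ) r * w i) p = 0 :=
    Finset.prod_eq_zero (Finset.mem_univ k)
      (Finset.prod_eq_zero (Finset.mem_univ 0) (by simp [h, ellTheta_one hp1]))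
  rw [typeITerm, h0, mul_zero, zero_div]

lemma typeITerm_cons_self {m n : ℕ} (t : Fin m → ℂ) {w : Fin (n + 1) → ℂ} {k : Fin (n + 1)}
    (hw : w k ≠ 0) (hk : ∀ i, ellTheta (w k * w i) p ≠ 0) :
    typeITerm p (Fin.cons (w k) t) w =
      (∏ r, ellTheta (t r * w k) p) * typeITerm p t fun i => w (k.succAbove i) := by
  have h1 : ∏ i, ellTheta (w k * w (k.succAbove i)) p ≠ 0 :=
    Finset.prod_ne_zero_iff.2 fun i _ => hk _
  simp only [typeITerm, thetaDenom_succAbove w k, Fin.prod_univ_succ (n := m), Fin.cons_zero,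
    Fin.cons_succ, Finset.prod_mul_distrib, Fin.prod_univ_succAbove _ k,
    mul_div_mul_left _ _ hw]
  have h2 (A a b c d D : ℂ) (ha : a ≠ 0) (hc : c ≠ 0) :
      A * (a * b * (c * d)) / (a * c * D) = b * (A * d / D) := by field_simp
  exact h2 _ _ _ _ _ _ (hk k) h1

lemma typeISum_cons_pw (hp1 : ‖p‖ < 1) {m n : ℕ} (t : Fin m → ℂ) {z : Fin (n + 1) → ℂ}
    (hz : ∀ i, z i ≠ 0) (hg : ThetaGeneric p z) (k : Fin (n + 1)) (b : Bool) :
    typeISum p (Fin.cons (pw (z k) b) t) z =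
      (∏ r, ellTheta (t r * pw (z k) b) p) * typeISum p t fun i => z (k.succAbove i) := by
  have hz0 : pw (z k) b ≠ 0 := pw_ne_zero (hz k) b
  rw [typeISum, ← (Fin.insertNthEquiv (fun _ => Bool) k).sum_comp, Fintype.sum_prod_type,
    Fintype.sum_eq_single b, typeISum, Finset.mul_sum]
  · refine Finset.sum_congr rfl fun σ _ => ?_
    have h := typeITerm_cons_self (p := p) t (k := k)
      (w := fun i => pw (z i) ((Fin.insertNthEquiv (fun _ => Bool) k) (b, σ) i))
      (by simpa using hz0) (fun i => hg _ _ _ _ (by rintro rfl; rfl))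
    simpa using h
  · intro c hc
    refine Finset.sum_eq_zero fun σ _ => typeITerm_cons_eq_zero hp1 (k := k) _ ?_
    obtain rfl : c = !b := by cases b <;> cases c <;> simp_all
    simp [pw_not, hz0]

lemma typeIProd_cons {m : ℕ} (x : ℂ) (t : Fin m → ℂ) :
    typeIProd p (Fin.cons x t) = (∏ r, ellTheta (t r * x) p) * typeIProd p t := by
  simp [typeIProd, Fin.prod_univ_succ, mul_comm x]

lemma prod_ellTheta_mul_left (hp0 : p ≠ 0) (hp1 : ‖p‖ < 1) {n : ℕ} {u : Fin n → ℂ}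
    (hu : ∀ i, u i ≠ 0) {x : ℂ} (hx : x ≠ 0) :
    x ^ n * ∏ i, ellTheta (p * x * u i) p =
      (-1) ^ n / (∏ i, u i) * ∏ i, ellTheta (x * u i) p := by
  have h (i : Fin n) : ellTheta (p * x * u i) p = -1 / u i * x⁻¹ * ellTheta (x * u i) p := by
    rw [mul_assoc, ellTheta_mul_left hp0 hp1 (mul_ne_zero hx (hu i))]
    field_simp
  simp only [h, Finset.prod_mul_distrib, Finset.prod_div_distrib, Finset.prod_const,
    Finset.card_univ, Fintype.card_fin, inv_pow]
  field_simp

lemma typeITerm_cons {m n : ℕ} (x : ℂ) (t : Fin m → ℂ) (w : Fin n → ℂ) :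
    typeITerm p (Fin.cons x t) w = ellTheta (x * ((∏ r, t r) / ∏ i, w i)) p *
      (∏ i, ellTheta (x * w i) p) * ((∏ i, ∏ r, ellTheta (t r * w i) p) / thetaDenom p w) := by
  simp only [typeITerm, Fin.prod_univ_succ, Fin.cons_zero, Fin.cons_succ, Finset.prod_mul_distrib]
  rw [mul_div_assoc x]
  ring

lemma typeITerm_cons_mul_left (hp0 : p ≠ 0) (hp1 : ‖p‖ < 1) {n : ℕ} {t : Fin (n + 1) → ℂ}
    (ht : ∀ r, t r ≠ 0) {w : Fin n → ℂ} (hw : ∀ i, w i ≠ 0) {x : ℂ} (hx : x ≠ 0) :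
    x ^ (n + 1) * typeITerm p (Fin.cons (p * x) t) w =
      (-1) ^ (n + 1) / (∏ r, t r) * typeITerm p (Fin.cons x t) w := by
  have hT : ∏ r, t r ≠ 0 := Finset.prod_ne_zero_iff.2 fun r _ => ht r
  have hW : ∏ i, w i ≠ 0 := Finset.prod_ne_zero_iff.2 fun i _ => hw i
  have h := prod_ellTheta_mul_left hp0 hp1 hw hx
  rw [typeITerm_cons, typeITerm_cons, mul_assoc p,
    ellTheta_mul_left hp0 hp1 (mul_ne_zero hx (div_ne_zero hT hW))]
  set A := ellTheta (x * ((∏ r, t r) / ∏ i, w i)) p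
  set B := (∏ i, ∏ r, ellTheta (t r * w i) p) / thetaDenom p w
  calc _ = -(A / (x * ((∏ r, t r) / ∏ i, w i))) * x * B *
        (x ^ n * ∏ i, ellTheta (p * x * w i) p) := by ring
    _ = _ := by
      rw [h]
      field_simp
      ring

lemma typeIProd_cons_mul_left (hp0 : p ≠ 0) (hp1 : ‖p‖ < 1) {m : ℕ} {t : Fin m → ℂ}
    (ht : ∀ r, t r ≠ 0) {x : ℂ} (hx : x ≠ 0) :
    x ^ m * typeIProd p (Fin.cons (p * x) t) =
      (-1) ^ m / (∏ r, t r) * typeIProd p (Fin.cons x t) := by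
  rw [typeIProd_cons, typeIProd_cons]
  simp only [mul_comm (t _)]
  rw [← mul_assoc, prod_ellTheta_mul_left hp0 hp1 ht hx, mul_assoc]

/-- The difference of the two sides of the type I identity. -/
noncomputable def typeIDiff (p : ℂ) {m n : ℕ} (t : Fin m → ℂ) (z : Fin n → ℂ) : ℂ :=
  typeISum p t z - typeIProd p t

lemma typeIDiff_cons_mul_left (hp0 : p ≠ 0) (hp1 : ‖p‖ < 1) {n : ℕ} {t : Fin (n + 1) → ℂ}
    (ht : ∀ r, t r ≠ 0) {z : Fin n → ℂ} (hz : ∀ i, z i ≠ 0) (x : ℂ) (hx : x ≠ 0) :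
    x ^ (n + 1) * typeIDiff p (Fin.cons (p * x) t) z =
      (-1) ^ (n + 1) / (∏ r, t r) * typeIDiff p (Fin.cons x t) z := by
  simp only [typeIDiff, mul_sub, typeISum, Finset.mul_sum, typeIProd_cons_mul_left hp0 hp1 ht hx,
    typeITerm_cons_mul_left hp0 hp1 ht (fun i => pw_ne_zero (hz i) _) hx]

lemma differentiableOn_ellTheta_mul (hp1 : ‖p‖ < 1) {c : ℂ} (hc : c ≠ 0) :
    DifferentiableOn ℂ (fun x => ellTheta (x * c) p) {0}ᶜ := fun x hx =>
  ((differentiableAt_ellTheta hp1 (mul_ne_zero hx hc)).comp (f := fun y => y * c) x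
    (by fun_prop)).differentiableWithinAt

lemma differentiableOn_typeIDiff_cons (hp1 : ‖p‖ < 1) {m n : ℕ} {t : Fin m → ℂ}
    (ht : ∀ r, t r ≠ 0) {z : Fin n → ℂ} (hz : ∀ i, z i ≠ 0) :
    DifferentiableOn ℂ (fun x => typeIDiff p (Fin.cons x t) z) {0}ᶜ := by
  simp only [typeIDiff, typeISum, typeITerm_cons, typeIProd_cons, mul_comm (t _)]
  refine (DifferentiableOn.fun_sum fun σ _ => ?_).sub (DifferentiableOn.mul_const ?_ _)
  · have hw (i : Fin n) := pw_ne_zero (hz i) (σ i)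
    refine ((differentiableOn_ellTheta_mul hp1 ?_).mul
      (DifferentiableOn.fun_finsetProd fun i _ => differentiableOn_ellTheta_mul hp1 (hw i))).mul_const _
    exact div_ne_zero (Finset.prod_ne_zero_iff.2 fun r _ => ht r)
      (Finset.prod_ne_zero_iff.2 fun i _ => hw i)
  · exact DifferentiableOn.fun_finsetProd fun r _ => differentiableOn_ellTheta_mul hp1 (ht r)

lemma typeIDiff_cons_pw (hp1 : ‖p‖ < 1) {m n : ℕ} (t : Fin m → ℂ) {z : Fin (n + 1) → ℂ}
    (hz : ∀ i, z i ≠ 0) (hg : ThetaGeneric p z) (k : Fin (n + 1)) (b : Bool) :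
    typeIDiff p (Fin.cons (pw (z k) b) t) z =
      (∏ r, ellTheta (t r * pw (z k) b) p) * typeIDiff p t fun i => z (k.succAbove i) := by
  rw [typeIDiff, typeISum_cons_pw hp1 t hz hg, typeIProd_cons, typeIDiff, mul_sub]

lemma ellTheta_pw_div_pw_ne_zero {n : ℕ} {z : Fin n → ℂ} (hg : ThetaGeneric p z)
    {u v : Fin n × Bool} (huv : u ≠ v) :
    ellTheta (pw (z u.1) u.2 / pw (z v.1) v.2) p ≠ 0 := by
  rw [div_eq_mul_inv, ← pw_not]
  refine hg _ _ _ _ fun h => ?_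
  obtain ⟨i, a⟩ := u
  obtain ⟨j, b⟩ := v
  obtain rfl : i = j := h
  cases a <;> cases b <;> simp_all

/-- The case of one variable and three parameters, written out. -/
lemma typeIDiff_one (hp1 : ‖p‖ < 1) (x y u : ℂ) {z : Fin 1 → ℂ} (hz : z 0 ≠ 0) :
    typeIDiff p (Fin.cons x (Fin.cons y (Fin.cons u ![]))) z =
      (ellTheta (x * y * u / z 0) p * (ellTheta (x * z 0) p * ellTheta (y * z 0) p *
        ellTheta (u * z 0) p) - z 0 ^ 2 * (ellTheta (x * y * u * z 0) p *
        (ellTheta (x / z 0) p * ellTheta (y / z 0) p * ellTheta (u / z 0) p))) /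
        ellTheta (z 0 * z 0) p -
      ellTheta (x * y) p * ellTheta (x * u) p * ellTheta (y * u) p := by
  have hsq : ellTheta ((z 0)⁻¹ / z 0) p = -(ellTheta (z 0 * z 0) p / (z 0 * z 0)) := by
    rw [← ellTheta_inv hp1 (mul_ne_zero hz hz), mul_inv, div_eq_mul_inv]
  rw [typeIDiff, typeISum, ← (Equiv.funUnique (Fin 1) Bool).symm.sum_comp]
  simp [typeITerm, thetaDenom, typeIProd, pw, Fin.prod_univ_succ, ← mul_assoc,
    ← div_eq_mul_inv]
  rw [hsq, div_neg, div_div_eq_mul_div]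
  ring

lemma typeIDiff_one_swap (hp1 : ‖p‖ < 1) (x y u : ℂ) {z : Fin 1 → ℂ} (hz : z 0 ≠ 0) :
    typeIDiff p (Fin.cons x (Fin.cons y (Fin.cons u ![]))) z =
      typeIDiff p (Fin.cons y (Fin.cons x (Fin.cons u ![]))) z := by
  rw [typeIDiff_one hp1 _ _ _ hz, typeIDiff_one hp1 _ _ _ hz, mul_comm y x]
  ring

lemma typeIDiff_one_inv (hp1 : ‖p‖ < 1) {y : ℂ} (hy : y ≠ 0) (u : ℂ) {z : Fin 1 → ℂ}
    (hz : z 0 ≠ 0) : typeIDiff p (Fin.cons y⁻¹ (Fin.cons y (Fin.cons u ![]))) z = 0 := by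
  have h1 : ellTheta (y⁻¹ * z 0) p = -(ellTheta (y / z 0) p / (y / z 0)) := by
    rw [← ellTheta_inv hp1 (div_ne_zero hy hz), inv_div, inv_mul_eq_div]
  have h2 : ellTheta (y⁻¹ / z 0) p = -(ellTheta (y * z 0) p / (y * z 0)) := by
    rw [← ellTheta_inv hp1 (mul_ne_zero hy hz), mul_inv, div_eq_mul_inv]
  rw [typeIDiff_one hp1 _ _ _ hz, inv_mul_cancel₀ hy, ellTheta_one hp1, h1, h2, one_mul]
  field_simp
  ring

theorem typeIDiff_one_eq_zero (hp0 : p ≠ 0) (hp1 : ‖p‖ < 1) {t : Fin 3 → ℂ} (ht : ∀ r, t r ≠ 0)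
    {z : Fin 1 → ℂ} (hz : ∀ i, z i ≠ 0) (hg : ThetaGeneric p z)
    (hbase : ∀ t' : Fin 2 → ℂ, typeIDiff p t' (Fin.elim0 : Fin 0 → ℂ) = 0) :
    typeIDiff p t z = 0 := by
  obtain ⟨x, y, u, rfl⟩ : ∃ x y u, t = Fin.cons x (Fin.cons y (Fin.cons u ![])) :=
    ⟨t 0, t 1, t 2, by funext i; fin_cases i <;> rfl⟩
  have hx : x ≠ 0 := ht 0
  have hy : y ≠ 0 := ht 1
  have hu : u ≠ 0 := ht 2
  have hC {v : ℂ} (hv : v ≠ 0) :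
      (-1 : ℂ) ^ 2 / ∏ r, (Fin.cons v (Fin.cons u ![]) : Fin 2 → ℂ) r ≠ 0 := by
    simp [Fin.prod_univ_succ, hu, hv]
  have hne {v : ℂ} (hv : v ≠ 0) : ∀ r, (Fin.cons v (Fin.cons u ![]) : Fin 2 → ℂ) r ≠ 0 := by
    intro r
    fin_cases r
    exacts [hv, hu]
  have hq {v : ℂ} (hv : v ≠ 0) := typeIDiff_cons_mul_left hp0 hp1 (hne hv) hz
  have hzero (v : ℂ) (b : Bool) :
      typeIDiff p (Fin.cons (pw (z 0) b) (Fin.cons v (Fin.cons u ![]))) z = 0 := by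
    rw [typeIDiff_cons_pw hp1 _ hz hg, Subsingleton.elim (fun i => z (Fin.succAbove 0 i)) Fin.elim0,
      hbase, mul_zero]
  by_cases hyz : ∃ b, ellTheta (y / pw (z 0) b) p = 0
  · obtain ⟨b, hb⟩ := hyz
    rw [typeIDiff_one_swap hp1 _ _ _ (hz 0)]
    exact eq_zero_of_ellTheta_div_eq_zero
      (f := fun v => typeIDiff p (Fin.cons v (Fin.cons x (Fin.cons u ![]))) z) hp0 hp1 (hC hx)
      (hq hx) (pw_ne_zero (hz 0) b) (hzero x b) hy hb
  push Not at hyz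
  have hyz' (b : Bool) : ellTheta (y * pw (z 0) b) p ≠ 0 := by
    simpa [pw_not, div_eq_mul_inv] using hyz (!b)
  refine eq_zero_of_card_lt hp0 hp1 (s := (Finset.univ : Finset (Option Bool)))
    (a := fun o => o.elim y⁻¹ fun b => pw (z 0) b)
    (f := fun v => typeIDiff p (Fin.cons v (Fin.cons y (Fin.cons u ![]))) z) ?_ ?_ (by simp)
    (differentiableOn_typeIDiff_cons hp1 (hne hy) hz) (hC hy) (hq hy) ?_ hx
  · rintro (_ | b) -
    exacts [inv_ne_zero hy, pw_ne_zero (hz 0) b]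
  · rintro (_ | a) - (_ | b) - hab
    · exact absurd rfl hab
    · have h : y⁻¹ / pw (z 0) b = (y * pw (z 0) b)⁻¹ := by rw [mul_inv, div_eq_mul_inv]
      have hne' := mul_ne_zero hy (pw_ne_zero (hz 0) b)
      simp only [Option.elim_none, Option.elim_some, h, ellTheta_inv hp1 hne']
      exact neg_ne_zero.2 (div_ne_zero (hyz' b) hne')
    · simpa [mul_comm] using hyz' a
    · exact ellTheta_pw_div_pw_ne_zero hg (u := (0, a)) (v := (0, b))
        fun h => hab (congrArg some (Prod.ext_iff.1 h).2)
  · rintro (_ | b) -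
    exacts [typeIDiff_one_inv hp1 hy u (hz 0), hzero y b]

theorem typeIDiff_eq_zero (hp0 : p ≠ 0) (hp1 : ‖p‖ < 1) {n : ℕ} {t : Fin (n + 2) → ℂ}
    (ht : ∀ r, t r ≠ 0) {z : Fin n → ℂ} (hz : ∀ i, z i ≠ 0) (hg : ThetaGeneric p z) :
    typeIDiff p t z = 0 := by
  have hbase (t : Fin 2 → ℂ) (z : Fin 0 → ℂ) : typeIDiff p t z = 0 := by
    simp [typeIDiff, typeISum, typeITerm, thetaDenom, typeIProd, Fin.prod_univ_succ]
  induction n with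
  | zero => exact hbase t z
  | succ n ih =>
    rcases Nat.eq_zero_or_pos n with rfl | hn
    · exact typeIDiff_one_eq_zero hp0 hp1 ht hz hg fun t' => hbase t' _
    · rw [← Fin.cons_self_tail t]
      have ht' (r : Fin (n + 2)) : Fin.tail t r ≠ 0 := ht r.succ
      refine eq_zero_of_card_lt hp0 hp1 (s := (Finset.univ : Finset (Fin (n + 1) × Bool)))
        (a := fun u => pw (z u.1) u.2) (f := fun v => typeIDiff p (Fin.cons v (Fin.tail t)) z)
        (fun u _ => pw_ne_zero (hz _) _)
        (fun u _ v _ huv => ellTheta_pw_div_pw_ne_zero hg huv) ?_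
        (differentiableOn_typeIDiff_cons hp1 ht' hz) ?_
        (typeIDiff_cons_mul_left hp0 hp1 ht' hz) (fun u _ => ?_) (ht 0)
      · simp
        omega
      · exact div_ne_zero (pow_ne_zero _ (neg_ne_zero.2 one_ne_zero))
          (Finset.prod_ne_zero_iff.2 fun r _ => ht' r)
      · rw [typeIDiff_cons_pw hp1 _ hz hg, ih ht' (fun i => hz _)
          (fun i j a b hab => hg _ _ a b fun h => hab (Fin.succAbove_right_injective h)), mul_zero]

lemma thetaGeneric_of_le_of_lt (hp1 : ‖p‖ < 1) {n : ℕ} {z : Fin n → ℂ} (hz : ∀ i, z i ≠ 0)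
    (h : ∀ i j : Fin n, i ≤ j → ellTheta (z i * z j) p ≠ 0)
    (h' : ∀ i j : Fin n, i < j → ellTheta (z i / z j) p ≠ 0) : ThetaGeneric p z := by
  have hinv {x : ℂ} (hx : x ≠ 0) (h : ellTheta x p ≠ 0) : ellTheta x⁻¹ p ≠ 0 := by
    rw [ellTheta_inv hp1 hx]
    exact neg_ne_zero.2 (div_ne_zero h hx)
  have hmul (i j : Fin n) : ellTheta (z i * z j) p ≠ 0 := by
    rcases le_total i j with hij | hij
    · exact h i j hij
    · simpa [mul_comm] using h j i hij
  have hdiv (i j : Fin n) (hij : i ≠ j) : ellTheta (z i / z j) p ≠ 0 := by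
    rcases lt_or_gt_of_ne hij with hij | hij
    · exact h' i j hij
    · simpa using hinv (div_ne_zero (hz j) (hz i)) (h' j i hij)
  intro i j a b hab
  cases a <;> cases b
  · simpa [pw, mul_comm] using hinv (mul_ne_zero (hz i) (hz j)) (hmul i j)
  · simpa [pw, div_eq_mul_inv, mul_comm] using hdiv j i fun hji => by simpa using hab hji.symm
  · simpa [pw, div_eq_mul_inv] using hdiv i j fun hij => by simpa using hab hij
  · simpa [pw] using hmul i j

end TypeI

/-- The theta-function summation identity behind the alternative proof of the
Type I integral. -/
theorem typeI_theta_sum (n : ℕ) (hn : 1 ≤ n) (p : ℂ)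
    (hp0 : 0 < ‖p‖) (hp1 : ‖p‖ < 1)
    (t : Fin (n + 2) → ℂ) (z : Fin n → ℂ)
    (ht0 : ∀ r, t r ≠ 0) (hz0 : ∀ i, z i ≠ 0)
    (hzij : ∀ i j : Fin n, i ≤ j → ellTheta (z i * z j) p ≠ 0)
    (hzij' : ∀ i j : Fin n, i < j → ellTheta (z i / z j) p ≠ 0) :
    (∑ σ : Fin n → Bool,
      ellTheta ((∏ r, t r) / ∏ i, pw (z i) (σ i)) p *
        (∏ i, ∏ r, ellTheta (t r * pw (z i) (σ i)) p) /
        ∏ i, ∏ j, if i ≤ j then ellTheta (pw (z i) (σ i) * pw (z j) (σ j)) p else 1) =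
      ∏ r, ∏ s, if r < s then ellTheta (t r * t s) p else 1 := by
  have hp : p ≠ 0 := norm_pos_iff.1 hp0
  exact sub_eq_zero.1
    (typeIDiff_eq_zero hp hp1 ht0 hz0 (thetaGeneric_of_le_of_lt hp1 hz0 hzij hzij'))
end

section
/- Let n ≥ 1 be an integer, let p ∈ ℂ with 0 < |p| < 1, and let t, x_0, ..., x_{n−1}, y_0, ..., y_{n−1} ∈ ℂ, all nonzero, with θ(t;p) ≠ 0 and θ(x_i y_j;p) ≠ 0 for all 0 ≤ i, j < n. Then det_{0≤i,j<n}( θ(t x_i y_j;p)/(θ(t;p) θ(x_i y_j;p)) ) = ( θ(t ∏_{i=0}^{n−1} x_i y_i;p)/θ(t;p) ) · ∏_{0≤i<j<n} x_j y_j θ(x_i/x_j;p) θ(y_i/y_j;p) · ∏_{0≤i,j<n} θ(x_i y_j;p)^{−1}. -/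
open scoped BigOperators Real

open Filter Topology

/-- The Gaussian binomial coefficient `[n, k]_p`. -/
def gaussBinom (p : ℂ) : ℕ → ℕ → ℂ
  | _, 0 => 1
  | 0, _ + 1 => 0
  | n + 1, k + 1 => gaussBinom p n k + p ^ (k + 1) * gaussBinom p n (k + 1)

theorem gaussBinom_zero_right (p : ℂ) (n : ℕ) : gaussBinom p n 0 = 1 := by
  cases n <;> simp [gaussBinom]

theorem gaussBinom_eq_zero_of_lt (p : ℂ) {n k : ℕ} (h : n < k) : gaussBinom p n k = 0 := by
  induction n generalizing k with
  | zero => cases k <;> simp_all [gaussBinom]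
  | succ n ih =>
    cases k with
    | zero => omega
    | succ k => simp [gaussBinom, ih (show n < k by omega), ih (show n < k + 1 by omega)]

/-- The finite `p`-Pochhammer symbol `(p;p)_n`. -/
def pochFactorial (p : ℂ) (n : ℕ) : ℂ := ∏ k ∈ Finset.range n, (1 - p ^ (k + 1))

theorem pochFactorial_succ (p : ℂ) (n : ℕ) :
    pochFactorial p (n + 1) = pochFactorial p n * (1 - p ^ (n + 1)) :=
  Finset.prod_range_succ _ _

theorem gaussBinom_mul_pochFactorial (p : ℂ) (i j : ℕ) :
    gaussBinom p (i + j) i * (pochFactorial p i * pochFactorial p j) =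
      pochFactorial p (i + j) := by
  induction h : i + j generalizing i j with
  | zero =>
    obtain ⟨rfl, rfl⟩ : i = 0 ∧ j = 0 := by omega
    simp [gaussBinom, pochFactorial]
  | succ m ih =>
    cases i with
    | zero =>
      obtain rfl : j = m + 1 := by omega
      rw [gaussBinom_zero_right]
      simp [pochFactorial]
    | succ i =>
      have h1 := ih i j (by omega)
      simp only [gaussBinom]
      cases j with
      | zero =>
        obtain rfl : i = m := by omega
        rw [gaussBinom_eq_zero_of_lt p (Nat.lt_succ_self i), pochFactorial_succ]
        linear_combination (1 - p ^ (i + 1)) * h1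
      | succ j =>
        have h2 := ih (i + 1) j (by omega)
        obtain rfl : m = i + j + 1 := by omega
        rw [pochFactorial_succ p i] at h2 ⊢
        rw [pochFactorial_succ p j] at h1 ⊢
        rw [pochFactorial_succ p (i + j + 1)]
        linear_combination (1 - p ^ (i + 1)) * h1 + p ^ (i + 1) * (1 - p ^ (j + 1)) * h2

/-- The general term of the bilateral theta series with nome `p = q ^ 2`. -/
noncomputable def thetaTerm (q x : ℂ) (n : ℤ) : ℂ := (-1) ^ n * q ^ (n ^ 2 - n) * x ^ n

theorem thetaTerm_succ {q : ℂ} (x : ℂ) (hq : q ≠ 0) (j : ℕ) :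
    thetaTerm q x ((j + 1 : ℕ) : ℤ) = -(q ^ 2) ^ j * x * thetaTerm q x j := by
  unfold thetaTerm
  have h : (((j + 1 : ℕ) : ℤ)) ^ 2 - ((j + 1 : ℕ) : ℤ) = ((j : ℤ) ^ 2 - j) + (2 * j : ℕ) := by
    push_cast; ring
  rw [h, zpow_add₀ hq, zpow_natCast, zpow_natCast, zpow_natCast, zpow_natCast, zpow_natCast,
    pow_mul]
  ring

theorem thetaTerm_mul (q x : ℂ) (a : ℂ) (j : ℤ) :
    thetaTerm q (a * x) j = a ^ j * thetaTerm q x j := by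
  simp only [thetaTerm, mul_zpow]; ring

theorem prod_one_sub_pow_mul {q z : ℂ} (hq : q ≠ 0) (hz : z ≠ 0) (M : ℕ) :
    ∏ k ∈ Finset.range M, (1 - (q ^ 2) ^ k * z) =
      ∑ j ∈ Finset.range (M + 1), gaussBinom (q ^ 2) M j * thetaTerm q z j := by
  induction M generalizing z with
  | zero => simp [gaussBinom, thetaTerm]
  | succ M ih =>
    have hz' : q ^ 2 * z ≠ 0 := mul_ne_zero (pow_ne_zero _ hq) hz
    have hshift : ∏ k ∈ Finset.range M, (1 - (q ^ 2) ^ (k + 1) * z) =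
        ∏ k ∈ Finset.range M, (1 - (q ^ 2) ^ k * (q ^ 2 * z)) :=
      Finset.prod_congr rfl fun k _ => by ring
    have hone : gaussBinom (q ^ 2) (M + 1) 0 * thetaTerm q z ((0 : ℕ) : ℤ) = 1 := by
      simp [gaussBinom, thetaTerm]
    have hone' : gaussBinom (q ^ 2) M 0 * thetaTerm q (q ^ 2 * z) ((0 : ℕ) : ℤ) = 1 := by
      simp [gaussBinom_zero_right, thetaTerm]
    rw [Finset.prod_range_succ', hshift, ih hz', Finset.sum_range_succ' _ (M + 1), hone]
    have hstep : ∀ j ∈ Finset.range (M + 1),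
        gaussBinom (q ^ 2) (M + 1) (j + 1) * thetaTerm q z ((j + 1 : ℕ) : ℤ) =
          -z * (gaussBinom (q ^ 2) M j * thetaTerm q (q ^ 2 * z) j) +
          gaussBinom (q ^ 2) M (j + 1) * thetaTerm q (q ^ 2 * z) ((j + 1 : ℕ) : ℤ) := by
      intro j _
      rw [thetaTerm_mul, thetaTerm_mul, thetaTerm_succ z hq, zpow_natCast, zpow_natCast]
      simp only [gaussBinom]
      ring
    have hlast := Finset.sum_range_succ'
      (fun j : ℕ => gaussBinom (q ^ 2) M j * thetaTerm q (q ^ 2 * z) j) (M + 1)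
    rw [Finset.sum_range_succ, gaussBinom_eq_zero_of_lt _ (Nat.lt_succ_self M), hone'] at hlast
    rw [Finset.sum_congr rfl hstep, Finset.sum_add_distrib, ← Finset.mul_sum]
    linear_combination hlast

theorem prod_one_sub_div {q x : ℂ} (hq : q ≠ 0) (hx : x ≠ 0) (N : ℕ) :
    ∏ k ∈ Finset.range N, (1 - (q ^ 2) ^ k * (x / (q ^ 2) ^ N)) =
      (-1) ^ N * x ^ N * q ^ (-((N : ℤ) ^ 2 + N)) *
        ∏ k ∈ Finset.range N, (1 - (q ^ 2) ^ (k + 1) / x) := by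
  induction N with
  | zero => simp
  | succ N ih =>
    have hshift : ∏ k ∈ Finset.range N, (1 - (q ^ 2) ^ (k + 1) * (x / (q ^ 2) ^ (N + 1))) =
        ∏ k ∈ Finset.range N, (1 - (q ^ 2) ^ k * (x / (q ^ 2) ^ N)) :=
      Finset.prod_congr rfl fun k _ => by field_simp; ring
    rw [Finset.prod_range_succ', hshift, ih, Finset.prod_range_succ]
    have h : (-(((N + 1 : ℕ) : ℤ) ^ 2 + ((N + 1 : ℕ) : ℤ))) =
        -((N : ℤ) ^ 2 + N) - ((2 * (N + 1) : ℕ) : ℤ) := by push_cast; ring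
    rw [h, zpow_sub₀ hq, zpow_natCast, pow_mul]
    field_simp
    ring

/-- The finite form of the Jacobi triple product identity. -/
theorem finite_jacobi_triple_product {q x : ℂ} (hq : q ≠ 0) (hx : x ≠ 0) (N : ℕ) :
    ∏ k ∈ Finset.range N, ((1 - (q ^ 2) ^ k * x) * (1 - (q ^ 2) ^ (k + 1) / x)) =
      ∑ n ∈ Finset.Icc (-(N : ℤ)) N,
        gaussBinom (q ^ 2) (2 * N) (n + N).toNat * thetaTerm q x n := by
  have hz : x / (q ^ 2) ^ N ≠ 0 := div_ne_zero hx (pow_ne_zero _ (pow_ne_zero _ hq))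
  have h := prod_one_sub_pow_mul hq hz (N + N)
  have hshift : ∏ k ∈ Finset.range N, (1 - (q ^ 2) ^ (N + k) * (x / (q ^ 2) ^ N)) =
      ∏ k ∈ Finset.range N, (1 - (q ^ 2) ^ k * x) :=
    Finset.prod_congr rfl fun k _ => by rw [pow_add]; field_simp
  rw [Finset.prod_range_add, hshift, prod_one_sub_div hq hx] at h
  have hc : (-1 : ℂ) ^ N * x ^ N * q ^ (-((N : ℤ) ^ 2 + N)) ≠ 0 :=
    mul_ne_zero (mul_ne_zero (pow_ne_zero _ (by norm_num)) (pow_ne_zero _ hx)) (zpow_ne_zero _ hq)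
  refine mul_left_cancel₀ hc ?_
  rw [Finset.prod_mul_distrib]
  refine Eq.trans (by ring) (h.trans ?_)
  rw [Finset.mul_sum]
  refine Finset.sum_bij' (fun j _ => (j : ℤ) - N) (fun n _ => (n + N).toNat) ?_ ?_ ?_ ?_ ?_
  · intro j hj
    simp only [Finset.mem_range, Finset.mem_Icc] at *
    omega
  · intro n hn
    simp only [Finset.mem_range, Finset.mem_Icc] at *
    omega
  · intro j hj
    simp
  · intro n hn
    simp only [Finset.mem_Icc] at *
    omega
  · intro j _
    have h1 : ((j : ℤ) - N + N).toNat = j := by simp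
    rw [h1, ← two_mul]
    have h2 : thetaTerm q (x / (q ^ 2) ^ N) j = (-1 : ℂ) ^ N * x ^ N *
        q ^ (-((N : ℤ) ^ 2 + N)) * thetaTerm q x ((j : ℤ) - N) := by
      have e1 : ((q ^ 2) ^ N : ℂ) = q ^ (2 * (N : ℤ)) := by
        rw [← pow_mul, ← zpow_natCast]; norm_cast
      have e2 : q ^ (((j : ℤ) - N) ^ 2 - ((j : ℤ) - N)) =
          q ^ ((j : ℤ) ^ 2 - j) * q ^ ((N : ℤ) ^ 2 + N) / q ^ (2 * (N : ℤ) * j) := by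
        rw [← zpow_add₀ hq, ← zpow_sub₀ hq]; ring_nf
      have e3 : ((-1 : ℂ) ^ N) * (-1) ^ N = 1 := by rw [← mul_pow]; simp
      unfold thetaTerm
      rw [e1, div_zpow, ← zpow_mul, e2, zpow_sub₀ hx, zpow_sub₀ (by norm_num : (-1 : ℂ) ≠ 0),
        zpow_neg]
      simp only [zpow_natCast]
      have e4 := zpow_ne_zero ((N : ℤ) ^ 2 + N) hq
      have e5 := zpow_ne_zero (2 * (N : ℤ) * j) hq
      field_simp
    rw [h2]
    ring

theorem norm_thetaTerm (q x : ℂ) (n : ℤ) :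
    ‖thetaTerm q x n‖ = ‖q‖ ^ (n ^ 2 - n) * ‖x‖ ^ n := by
  simp [thetaTerm]

theorem summable_thetaTerm_bound {r R : ℝ} (hr0 : 0 < r) (hr1 : r < 1) (hR : 0 < R) :
    Summable fun n : ℤ => r ^ (n ^ 2 - n) * R ^ |n| := by
  have hT : 0 < -Real.log r / π := div_pos (neg_pos.2 (Real.log_neg hr0 hr1)) Real.pi_pos
  refine (summable_pow_mul_jacobiTheta₂_term_bound
    ((Real.log R - Real.log r) / (2 * π)) hT 0).of_nonneg_of_le (fun n => by positivity) fun n => ?_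
  have h1 : r ^ (n ^ 2 - n) = Real.exp (Real.log r * ((n ^ 2 - n : ℤ) : ℝ)) := by
    rw [← Real.rpow_intCast, Real.rpow_def_of_pos hr0]
  have h2 : R ^ |n| = Real.exp (Real.log R * ((|n| : ℤ) : ℝ)) := by
    rw [← Real.rpow_intCast, Real.rpow_def_of_pos hR]
  rw [pow_zero, one_mul, h1, h2, ← Real.exp_add, Real.exp_le_exp]
  have h3 : -π * (-Real.log r / π * (n : ℝ) ^ 2 -
      2 * ((Real.log R - Real.log r) / (2 * π)) * |(n : ℝ)|) =
      Real.log r * (n : ℝ) ^ 2 + (Real.log R - Real.log r) * |(n : ℝ)| := by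
    have := Real.pi_ne_zero
    field_simp
    ring
  have h4 := le_abs_self (n : ℝ)
  have h5 := Real.log_neg hr0 hr1
  push_cast
  refine le_of_le_of_eq ?_ h3.symm
  nlinarith

theorem zpow_le_zpow_abs {x R : ℝ} (hx : 0 < x) (h1 : x ≤ R) (h2 : x⁻¹ ≤ R) (n : ℤ) :
    x ^ n ≤ R ^ |n| := by
  rcases le_total 0 n with h | h
  · rw [abs_of_nonneg h]
    exact zpow_le_zpow_left₀ h hx.le h1
  · rw [abs_of_nonpos h, ← inv_inv x, inv_zpow']
    exact zpow_le_zpow_left₀ (by omega) (inv_pos.2 hx).le h2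

theorem summable_norm_thetaTerm {q x : ℂ} (hq : q ≠ 0) (hq1 : ‖q‖ < 1) (hx : x ≠ 0) :
    Summable fun n : ℤ => ‖thetaTerm q x n‖ := by
  have hx' := norm_pos_iff.2 hx
  refine (summable_thetaTerm_bound (norm_pos_iff.2 hq) hq1
    (lt_max_of_lt_left hx' : 0 < max ‖x‖ ‖x‖⁻¹)).of_nonneg_of_le (fun _ => norm_nonneg _) fun n => ?_
  rw [norm_thetaTerm]
  gcongr
  exact zpow_le_zpow_abs hx' (le_max_left _ _) (le_max_right _ _) n

/-- The bilateral theta series with nome `p = q ^ 2`. -/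
noncomputable def thetaSeries (q x : ℂ) : ℂ := ∑' n : ℤ, thetaTerm q x n

theorem continuousAt_thetaSeries {q x : ℂ} (hq : q ≠ 0) (hq1 : ‖q‖ < 1) (hx : x ≠ 0) :
    ContinuousAt (thetaSeries q) x := by
  have hx' := norm_pos_iff.2 hx
  obtain ⟨R, hR⟩ := exists_gt (max ‖x‖ ‖x‖⁻¹)
  have hR1 : ‖x‖ < R := (le_max_left _ _).trans_lt hR
  have hR2 : ‖x‖⁻¹ < R := (le_max_right _ _).trans_lt hR
  have hs : {y : ℂ | y ≠ 0 ∧ ‖y‖ ≤ R ∧ ‖y‖⁻¹ ≤ R} ∈ 𝓝 x := by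
    have c1 : ContinuousAt (fun y : ℂ => ‖y‖) x := continuous_norm.continuousAt
    have c2 : ContinuousAt (fun y : ℂ => ‖y‖⁻¹) x := c1.inv₀ hx'.ne'
    filter_upwards [isOpen_ne.mem_nhds hx, c1.eventually (gt_mem_nhds hR1),
      c2.eventually (gt_mem_nhds hR2)] with y h0 h1 h2
    exact ⟨h0, h1.le, h2.le⟩
  refine ContinuousOn.continuousAt ?_ hs
  refine continuousOn_tsum (fun n y hy => ?_)
    (summable_thetaTerm_bound (norm_pos_iff.2 hq) hq1 (hx'.trans hR1)) fun n y hy => ?_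
  · exact (continuousAt_const.mul (continuousAt_zpow₀ y n (Or.inl hy.1))).continuousWithinAt
  · rw [norm_thetaTerm]
    gcongr
    exact zpow_le_zpow_abs (norm_pos_iff.2 hy.1) hy.2.1 hy.2.2 n

theorem thetaSeries_inv {q x : ℂ} (hx : x ≠ 0) :
    thetaSeries q x⁻¹ = -thetaSeries q x / x := by
  have h : ∀ n : ℤ, thetaTerm q x (1 - n) = -x * thetaTerm q x⁻¹ n := by
    intro n
    unfold thetaTerm
    rw [show (1 - n) ^ 2 - (1 - n) = n ^ 2 - n by ring, zpow_sub₀ hx,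
      zpow_sub₀ (by norm_num : (-1 : ℂ) ≠ 0), inv_zpow]
    have : ((-1 : ℂ) ^ n) * (-1) ^ n = 1 := by rw [← mul_zpow]; simp
    have h1 : ((-1 : ℂ) ^ n) ≠ 0 := zpow_ne_zero _ (by norm_num)
    have h2 := zpow_ne_zero n hx
    field_simp
    linear_combination q ^ (n ^ 2 - n) * this
  have h' : thetaSeries q x = -x * thetaSeries q x⁻¹ := by
    unfold thetaSeries
    rw [← (Equiv.subLeft (1 : ℤ)).tsum_eq (thetaTerm q x), ← tsum_mul_left]
    exact tsum_congr h
  rw [h']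
  field_simp

theorem summable_norm_neg_pow_mul {p : ℂ} (hp1 : ‖p‖ < 1) (c : ℂ) :
    Summable fun k : ℕ => ‖-(p ^ k * c)‖ := by
  simpa using (summable_geometric_of_lt_one (norm_nonneg p) hp1).mul_right ‖c‖

theorem multipliable_one_sub_pow_mul {p : ℂ} (hp1 : ‖p‖ < 1) (c : ℂ) :
    Multipliable fun k : ℕ => 1 - p ^ k * c := by
  simpa [sub_eq_add_neg] using multipliable_one_add_of_summable (summable_norm_neg_pow_mul hp1 c)

theorem tprod_one_sub_pow_mul_ne_zero {p : ℂ} (hp1 : ‖p‖ < 1) {c : ℂ}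
    (h : ∀ k : ℕ, p ^ k * c ≠ 1) : ∏' k : ℕ, (1 - p ^ k * c) ≠ 0 := by
  simp only [sub_eq_add_neg]
  refine tprod_one_add_ne_zero_of_summable (fun k => ?_) (summable_norm_neg_pow_mul hp1 c)
  rw [← sub_eq_add_neg]
  exact sub_ne_zero.2 (h k).symm

theorem pow_ne_one_of_norm_lt_one {p : ℂ} (hp1 : ‖p‖ < 1) (k : ℕ) : p ^ (k + 1) ≠ 1 := by
  intro h
  have := pow_lt_one₀ (norm_nonneg p) hp1 (Nat.succ_ne_zero k)
  rw [← norm_pow, h] at this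
  simp at this

theorem pochFactorial_ne_zero {p : ℂ} (hp1 : ‖p‖ < 1) (n : ℕ) : pochFactorial p n ≠ 0 :=
  Finset.prod_ne_zero_iff.2 fun k _ => sub_ne_zero.2 (pow_ne_one_of_norm_lt_one hp1 k).symm

theorem exists_tendsto_pochFactorial {p : ℂ} (hp1 : ‖p‖ < 1) :
    ∃ g : ℂ, g ≠ 0 ∧ Tendsto (pochFactorial p) atTop (𝓝 g) := by
  refine ⟨∏' k : ℕ, (1 - p ^ k * p),
    tprod_one_sub_pow_mul_ne_zero hp1 fun k => ?_, ?_⟩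
  · rw [← pow_succ]
    exact pow_ne_one_of_norm_lt_one hp1 k
  · have h := (multipliable_one_sub_pow_mul hp1 p).hasProd.tendsto_prod_nat
    simp only [← pow_succ] at h ⊢
    exact h

theorem multipliable_ellTheta {p : ℂ} (hp1 : ‖p‖ < 1) (x : ℂ) :
    Multipliable fun k : ℕ => (1 - p ^ k * x) * (1 - p ^ (k + 1) / x) := by
  refine (multipliable_one_sub_pow_mul hp1 x).mul ?_
  simpa only [pow_succ, mul_div_assoc] using multipliable_one_sub_pow_mul hp1 (p / x)

theorem ellTheta_ne_zero {p x : ℂ} (hp1 : ‖p‖ < 1) (hx : x ≠ 0)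
    (h : ∀ k : ℤ, p ^ k ≠ x) : ellTheta x p ≠ 0 := by
  have h2 : Multipliable fun k : ℕ => 1 - p ^ (k + 1) / x := by
    simpa only [pow_succ, mul_div_assoc] using multipliable_one_sub_pow_mul hp1 (p / x)
  rw [ellTheta, (multipliable_one_sub_pow_mul hp1 x).tprod_mul h2]
  refine mul_ne_zero (tprod_one_sub_pow_mul_ne_zero hp1 fun k hk => h (-k) ?_) ?_
  · rw [zpow_neg, zpow_natCast]
    exact inv_eq_of_mul_eq_one_right hk
  · simp only [pow_succ, mul_div_assoc]
    refine tprod_one_sub_pow_mul_ne_zero hp1 fun k hk => h (k + 1 : ℕ) ?_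
    rw [zpow_natCast, pow_succ]
    rw [← mul_div_assoc, div_eq_one_iff_eq hx] at hk
    exact hk

theorem countable_ellTheta_zeros {p : ℂ} (hp1 : ‖p‖ < 1) :
    {x : ℂ | x = 0 ∨ ellTheta x p = 0}.Countable := by
  refine ((Set.countable_range fun k : ℤ => p ^ k).insert 0).mono ?_
  intro x hx
  by_contra hne
  simp only [Set.mem_insert_iff, Set.mem_range, not_or, not_exists] at hne
  exact hx.elim hne.1 (ellTheta_ne_zero hp1 hne.1 hne.2)

/-- A form of the Jacobi triple product identity with unspecified constant. -/
theorem exists_ellTheta_eq_mul_thetaSeries {q : ℂ} (hq : q ≠ 0) (hq1 : ‖q‖ < 1) :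
    ∃ c : ℂ, ∀ x : ℂ, x ≠ 0 → ellTheta x (q ^ 2) = c * thetaSeries q x := by
  have hp1 : ‖q ^ 2‖ < 1 := by
    rw [norm_pow]; exact pow_lt_one₀ (norm_nonneg q) hq1 two_ne_zero
  obtain ⟨g, hg, hlim⟩ := exists_tendsto_pochFactorial hp1
  refine ⟨g⁻¹, fun x hx => ?_⟩
  have hinv := hlim.inv₀ hg
  obtain ⟨B, hB⟩ := (Metric.isBounded_range_of_tendsto _ hlim).exists_norm_le
  obtain ⟨D, hD⟩ := (Metric.isBounded_range_of_tendsto _ hinv).exists_norm_le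
  simp only [Set.forall_mem_range] at hB hD
  have hB0 : 0 ≤ B := (norm_nonneg _).trans (hB 0)
  have hD0 : 0 ≤ D := (norm_nonneg _).trans (hD 0)
  have hcoef : ∀ N : ℕ, ∀ n : ℤ, n ∈ Finset.Icc (-(N : ℤ)) N →
      gaussBinom (q ^ 2) (2 * N) (n + N).toNat = pochFactorial (q ^ 2) (2 * N) *
        ((pochFactorial (q ^ 2) (N + n).toNat)⁻¹ * (pochFactorial (q ^ 2) (N - n).toNat)⁻¹) := by
    intro N n hn
    rw [Finset.mem_Icc] at hn
    have h := gaussBinom_mul_pochFactorial (q ^ 2) (N + n).toNat (N - n).toNat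
    rw [show (N + n).toNat + (N - n).toNat = 2 * N by omega] at h
    rw [add_comm n, ← h, ← mul_inv, mul_inv_cancel_right₀]
    exact mul_ne_zero (pochFactorial_ne_zero hp1 _) (pochFactorial_ne_zero hp1 _)
  let f : ℕ → ℤ → ℂ := fun N n => if n ∈ Finset.Icc (-(N : ℤ)) N then
    gaussBinom (q ^ 2) (2 * N) (n + N).toNat * thetaTerm q x n else 0
  have hf : ∀ N, ∑' n, f N n =
      ∏ k ∈ Finset.range N, ((1 - (q ^ 2) ^ k * x) * (1 - (q ^ 2) ^ (k + 1) / x)) := by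
    intro N
    rw [finite_jacobi_triple_product hq hx, tsum_eq_sum (s := Finset.Icc (-(N : ℤ)) N)]
    · exact Finset.sum_congr rfl fun n hn => if_pos hn
    · exact fun n hn => if_neg hn
  have hbound : ∀ N n, ‖f N n‖ ≤ B * (D * D) * ‖thetaTerm q x n‖ := by
    intro N n
    by_cases hn : n ∈ Finset.Icc (-(N : ℤ)) N
    · simp only [f, if_pos hn]
      rw [hcoef N n hn, norm_mul, norm_mul, norm_mul]
      gcongr
      exacts [hB _, hD _, hD _]
    · simp only [f, if_neg hn, norm_zero]
      positivity
  have hterm : ∀ n, Tendsto (fun N => f N n) atTop (𝓝 (g⁻¹ * thetaTerm q x n)) := by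
    intro n
    have t0 : Tendsto (fun N : ℕ => 2 * N) atTop atTop :=
      tendsto_atTop_mono (fun N => Nat.le_mul_of_pos_left N two_pos) tendsto_id
    have t1 : Tendsto (fun N : ℕ => ((N : ℤ) + n).toNat) atTop atTop :=
      tendsto_atTop_atTop.2 fun b => ⟨b + n.natAbs, fun N hN => by omega⟩
    have t2 : Tendsto (fun N : ℕ => ((N : ℤ) - n).toNat) atTop atTop :=
      tendsto_atTop_atTop.2 fun b => ⟨b + n.natAbs, fun N hN => by omega⟩
    have t := ((hlim.comp t0).mul ((hinv.comp t1).mul (hinv.comp t2))).mul_const (thetaTerm q x n)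
    rw [mul_inv_cancel_left₀ hg] at t
    refine t.congr' ?_
    filter_upwards [eventually_ge_atTop n.natAbs] with N hN
    have hn : n ∈ Finset.Icc (-(N : ℤ)) N := by rw [Finset.mem_Icc]; omega
    simp only [f, if_pos hn, hcoef N n hn, Function.comp_apply]
  have h1 := tendsto_tsum_of_dominated_convergence
    ((summable_norm_thetaTerm hq hq1 hx).mul_left (B * (D * D))) hterm
    (Eventually.of_forall hbound)
  simp only [hf] at h1
  rw [tsum_mul_left] at h1
  exact tendsto_nhds_unique (multipliable_ellTheta hp1 x).hasProd.tendsto_prod_nat h1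

theorem thetaTerm_sq_neg_sq (q x : ℂ) (a : ℤ) :
    thetaTerm (q ^ 2) (-x ^ 2) a = q ^ (2 * (a ^ 2 - a)) * x ^ (2 * a) := by
  unfold thetaTerm
  rw [← neg_one_mul (x ^ 2), mul_zpow, zpow_mul, zpow_mul]
  have h : ((-1 : ℂ) ^ a) * (-1) ^ a = 1 := by rw [← mul_zpow]; simp
  norm_cast at h ⊢
  linear_combination (q ^ 2) ^ (a ^ 2 - a) * (x ^ 2) ^ a * h

theorem thetaTerm_mul_thetaTerm_even {q x y : ℂ} (hq : q ≠ 0) (hx : x ≠ 0) (hy : y ≠ 0)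
    (a b : ℤ) :
    thetaTerm q (x * y) (a + b) * thetaTerm q (x / y) (a - b) =
      thetaTerm (q ^ 2) (-x ^ 2) a * thetaTerm (q ^ 2) (-(q * y) ^ 2) b := by
  rw [thetaTerm_sq_neg_sq, thetaTerm_sq_neg_sq]
  unfold thetaTerm
  have h1 : ((-1 : ℂ) ^ (a + b)) * (-1) ^ (a - b) = 1 := by
    rw [← zpow_add₀ (by norm_num)]; exact Even.neg_one_zpow ⟨a, by ring⟩
  have h2 : q ^ ((a + b) ^ 2 - (a + b)) * q ^ ((a - b) ^ 2 - (a - b)) =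
      q ^ (2 * (a ^ 2 - a)) * (q ^ (2 * (b ^ 2 - b)) * q ^ (2 * b)) := by
    simp only [← zpow_add₀ hq]; ring_nf
  have h3 : x ^ (a + b) * x ^ (a - b) = x ^ (2 * a) := by
    rw [← zpow_add₀ hx]; ring_nf
  have h4 : y ^ (a + b) / y ^ (a - b) = y ^ (2 * b) := by
    rw [← zpow_sub₀ hy]; ring_nf
  rw [mul_zpow, div_zpow, mul_zpow q, ← h3, ← h4]
  linear_combination (x ^ (a + b) * x ^ (a - b) * (y ^ (a + b) / y ^ (a - b))) *
    (q ^ ((a + b) ^ 2 - (a + b)) * q ^ ((a - b) ^ 2 - (a - b)) * h1 + h2)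

theorem thetaTerm_mul_thetaTerm_odd {q x y : ℂ} (hq : q ≠ 0) (hx : x ≠ 0) (hy : y ≠ 0)
    (a b : ℤ) :
    thetaTerm q (x * y) (a + b) * thetaTerm q (x / y) (a - b + 1) =
      -(x / y) * (thetaTerm (q ^ 2) (-(q * x) ^ 2) a * thetaTerm (q ^ 2) (-y ^ 2) b) := by
  rw [thetaTerm_sq_neg_sq, thetaTerm_sq_neg_sq]
  unfold thetaTerm
  have h1 : ((-1 : ℂ) ^ (a + b)) * (-1) ^ (a - b + 1) = -1 := by
    rw [← zpow_add₀ (by norm_num)]; exact Odd.neg_one_zpow ⟨a, by ring⟩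
  have h2 : q ^ ((a + b) ^ 2 - (a + b)) * q ^ ((a - b + 1) ^ 2 - (a - b + 1)) =
      q ^ (2 * (a ^ 2 - a)) * q ^ (2 * a) * q ^ (2 * (b ^ 2 - b)) := by
    simp only [← zpow_add₀ hq]; ring_nf
  have h3 : x ^ (a + b) * x ^ (a - b + 1) = x ^ (2 * a) * x := by
    rw [← zpow_add₀ hx, ← zpow_add_one₀ hx]; ring_nf
  have h4 : y ^ (a + b) / y ^ (a - b + 1) = y ^ (2 * b) / y := by
    rw [← zpow_sub₀ hy, div_eq_mul_inv, ← zpow_sub_one₀ hy]; ring_nf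
  rw [mul_zpow, div_zpow, mul_zpow q]
  linear_combination (x ^ (a + b) * x ^ (a - b + 1) * (y ^ (a + b) / y ^ (a - b + 1))) *
    (q ^ ((a + b) ^ 2 - (a + b)) * q ^ ((a - b + 1) ^ 2 - (a - b + 1)) * h1 - h2) -
    q ^ (2 * (a ^ 2 - a)) * q ^ (2 * a) * q ^ (2 * (b ^ 2 - b)) *
    (y ^ (a + b) / y ^ (a - b + 1) * h3 + x ^ (2 * a) * x * h4)

theorem norm_sq_lt_one {q : ℂ} (hq1 : ‖q‖ < 1) : ‖q ^ 2‖ < 1 := by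
  rw [norm_pow]
  exact pow_lt_one₀ (norm_nonneg q) hq1 two_ne_zero

theorem thetaSeries_mul_thetaSeries_div {q x y : ℂ} (hq : q ≠ 0) (hq1 : ‖q‖ < 1) (hx : x ≠ 0)
    (hy : y ≠ 0) :
    thetaSeries q (x * y) * thetaSeries q (x / y) =
      thetaSeries (q ^ 2) (-x ^ 2) * thetaSeries (q ^ 2) (-(q * y) ^ 2) -
        x / y * (thetaSeries (q ^ 2) (-(q * x) ^ 2) * thetaSeries (q ^ 2) (-y ^ 2)) := by
  have hq2 : q ^ 2 ≠ 0 := pow_ne_zero _ hq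
  have hq21 := norm_sq_lt_one hq1
  have hS : ∀ {z : ℂ}, z ≠ 0 → Summable fun n => ‖thetaTerm (q ^ 2) (-z ^ 2) n‖ := fun hz =>
    summable_norm_thetaTerm hq2 hq21 (neg_ne_zero.2 (pow_ne_zero _ hz))
  have hprod : ∀ {z w : ℂ}, z ≠ 0 → w ≠ 0 → HasSum
      (fun m : ℤ × ℤ => thetaTerm (q ^ 2) (-z ^ 2) m.1 * thetaTerm (q ^ 2) (-w ^ 2) m.2)
      (thetaSeries (q ^ 2) (-z ^ 2) * thetaSeries (q ^ 2) (-w ^ 2)) := by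
    intro z w hz hw
    unfold thetaSeries
    rw [tsum_mul_tsum_of_summable_norm (hS hz) (hS hw)]
    exact (summable_mul_of_summable_norm (hS hz) (hS hw)).hasSum
  let e : ℤ × ℤ → ℤ × ℤ := fun m => (m.1 + m.2, m.1 - m.2)
  let o : ℤ × ℤ → ℤ × ℤ := fun m => (m.1 + m.2, m.1 - m.2 + 1)
  have he : Function.Injective e := by
    rintro ⟨a, b⟩ ⟨c, d⟩ h
    simp only [e, Prod.mk.injEq] at h ⊢
    omega
  have ho : Function.Injective o := by
    rintro ⟨a, b⟩ ⟨c, d⟩ h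
    simp only [o, Prod.mk.injEq] at h ⊢
    omega
  have hc : IsCompl (Set.range e) (Set.range o) := by
    refine IsCompl.of_eq (Set.eq_empty_of_forall_notMem ?_) (Set.eq_univ_of_forall ?_)
    · rintro _ ⟨⟨⟨a, b⟩, rfl⟩, ⟨c, d⟩, h⟩
      simp only [e, o, Prod.mk.injEq] at h
      omega
    · rintro ⟨m, n⟩
      rcases Int.emod_two_eq_zero_or_one (m + n) with h | h
      · refine Or.inl ⟨((m + n) / 2, (m - n) / 2), ?_⟩
        simp only [e, Prod.mk.injEq]
        omega
      · refine Or.inr ⟨((m + n - 1) / 2, (m - n + 1) / 2), ?_⟩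
        simp only [o, Prod.mk.injEq]
        omega
  let f : ℤ × ℤ → ℂ := fun m => thetaTerm q (x * y) m.1 * thetaTerm q (x / y) m.2
  have heven : HasSum (f ∘ e)
      (thetaSeries (q ^ 2) (-x ^ 2) * thetaSeries (q ^ 2) (-(q * y) ^ 2)) := by
    refine (hprod hx (mul_ne_zero hq hy)).congr_fun
      fun m => thetaTerm_mul_thetaTerm_even hq hx hy m.1 m.2
  have hodd : HasSum (f ∘ o)
      (-(x / y) * (thetaSeries (q ^ 2) (-(q * x) ^ 2) * thetaSeries (q ^ 2) (-y ^ 2))) := by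
    refine ((hprod (mul_ne_zero hq hx) hy).mul_left (-(x / y))).congr_fun
      fun m => thetaTerm_mul_thetaTerm_odd hq hx hy m.1 m.2
  have hsum := (he.hasSum_range_iff.2 heven).add_isCompl (f := f) hc (ho.hasSum_range_iff.2 hodd)
  have hl : thetaSeries q (x * y) * thetaSeries q (x / y) = ∑' m, f m :=
    tsum_mul_tsum_of_summable_norm (summable_norm_thetaTerm hq hq1 (mul_ne_zero hx hy))
      (summable_norm_thetaTerm hq hq1 (div_ne_zero hx hy))
  rw [hl, hsum.tsum_eq]
  ring

theorem ellTheta_addition {p t x₀ x₁ y₀ y₁ : ℂ} (hp0 : p ≠ 0) (hp1 : ‖p‖ < 1) (ht : t ≠ 0)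
    (hx₀ : x₀ ≠ 0) (hx₁ : x₁ ≠ 0) (hy₀ : y₀ ≠ 0) (hy₁ : y₁ ≠ 0) :
    ellTheta (t * x₀ * y₀) p * ellTheta (t * x₁ * y₁) p * ellTheta (x₀ * y₁) p *
        ellTheta (x₁ * y₀) p -
      ellTheta (t * x₀ * y₁) p * ellTheta (t * x₁ * y₀) p * ellTheta (x₀ * y₀) p *
        ellTheta (x₁ * y₁) p =
      ellTheta t p * ellTheta (t * (x₀ * y₀) * x₁ * y₁) p * (x₁ * y₁) *
        (ellTheta (x₀ / x₁) p * ellTheta (y₀ / y₁) p) := by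
  obtain ⟨q, rfl⟩ := IsAlgClosed.exists_pow_nat_eq p two_pos
  obtain ⟨u₀, rfl⟩ := IsAlgClosed.exists_pow_nat_eq x₀ two_pos
  obtain ⟨u₁, rfl⟩ := IsAlgClosed.exists_pow_nat_eq x₁ two_pos
  obtain ⟨v₀, rfl⟩ := IsAlgClosed.exists_pow_nat_eq y₀ two_pos
  obtain ⟨v₁, rfl⟩ := IsAlgClosed.exists_pow_nat_eq y₁ two_pos
  have hq : q ≠ 0 := by rintro rfl; simp at hp0
  have hu₀ : u₀ ≠ 0 := by rintro rfl; simp at hx₀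
  have hu₁ : u₁ ≠ 0 := by rintro rfl; simp at hx₁
  have hv₀ : v₀ ≠ 0 := by rintro rfl; simp at hy₀
  have hv₁ : v₁ ≠ 0 := by rintro rfl; simp at hy₁
  have hq1 : ‖q‖ < 1 := by
    rw [norm_pow] at hp1
    exact (pow_lt_one_iff_of_nonneg (norm_nonneg q) two_ne_zero).1 hp1
  obtain ⟨c, hc⟩ := exists_ellTheta_eq_mul_thetaSeries hq hq1
  have key : ∀ {a b z w : ℂ}, a ≠ 0 → b ≠ 0 → z = a * b → w = a / b →
      thetaSeries q z * thetaSeries q w =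
        a * (thetaSeries (q ^ 2) (-a ^ 2) / a * thetaSeries (q ^ 2) (-(q * b) ^ 2) -
          thetaSeries (q ^ 2) (-(q * a) ^ 2) * (thetaSeries (q ^ 2) (-b ^ 2) / b)) := by
    rintro a b z w ha hb rfl rfl
    rw [thetaSeries_mul_thetaSeries_div hq hq1 ha hb]
    field_simp
  have inv : ∀ {z : ℂ}, z ≠ 0 → thetaSeries q z = -z * thetaSeries q z⁻¹ := fun hz => by
    rw [thetaSeries_inv hz]; field_simp
  set a := t * u₀ * u₁ * v₀ * v₁ with ha
  set b := u₀ * v₀ / (u₁ * v₁) with hb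
  set c' := u₀ * v₁ / (u₁ * v₀) with hc'
  set d := u₀ * u₁ * v₀ * v₁ with hd
  have ha0 : a ≠ 0 := by simp [*]
  have hb0 : b ≠ 0 := by simp [*]
  have hc0 : c' ≠ 0 := by simp [*]
  have hd0 : d ≠ 0 := by simp [*]
  have k1 := key (z := t * u₀ ^ 2 * v₀ ^ 2) (w := t * u₁ ^ 2 * v₁ ^ 2) ha0 hb0
    (by rw [ha, hb]; field_simp) (by rw [ha, hb]; field_simp)
  have k2 := key (z := u₀ ^ 2 * v₁ ^ 2) (w := (u₁ ^ 2 * v₀ ^ 2)⁻¹) hc0 hd0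
    (by rw [hc', hd]; field_simp) (by rw [hc', hd]; field_simp)
  have k3 := key (z := t * u₀ ^ 2 * v₁ ^ 2) (w := t * u₁ ^ 2 * v₀ ^ 2) ha0 hc0
    (by rw [ha, hc']; field_simp) (by rw [ha, hc']; field_simp)
  have k4 := key (z := u₀ ^ 2 * v₀ ^ 2) (w := (u₁ ^ 2 * v₁ ^ 2)⁻¹) hb0 hd0
    (by rw [hb, hd]; field_simp) (by rw [hb, hd]; field_simp)
  have k5 := key (z := t * (u₀ ^ 2 * v₀ ^ 2) * u₁ ^ 2 * v₁ ^ 2) (w := t) ha0 hd0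
    (by rw [ha, hd]; ring) (by rw [ha, hd]; field_simp)
  have k6 := key (z := u₀ ^ 2 / u₁ ^ 2) (w := v₀ ^ 2 / v₁ ^ 2) hb0 hc0
    (by rw [hb, hc']; field_simp) (by rw [hb, hc']; field_simp)
  have hbc : u₁ ^ 2 * v₀ ^ 2 * c' = u₁ ^ 2 * v₁ ^ 2 * b := by
    rw [hb, hc']; field_simp
  clear_value a b c' d
  rw [hc (t * u₀ ^ 2 * v₀ ^ 2) (by positivity), hc (t * u₁ ^ 2 * v₁ ^ 2) (by positivity),
    hc (u₀ ^ 2 * v₁ ^ 2) (by positivity), hc (u₁ ^ 2 * v₀ ^ 2) (by positivity),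
    hc (t * u₀ ^ 2 * v₁ ^ 2) (by positivity), hc (t * u₁ ^ 2 * v₀ ^ 2) (by positivity),
    hc (u₀ ^ 2 * v₀ ^ 2) (by positivity), hc (u₁ ^ 2 * v₁ ^ 2) (by positivity),
    hc t ht, hc (t * (u₀ ^ 2 * v₀ ^ 2) * u₁ ^ 2 * v₁ ^ 2) (by positivity),
    hc (u₀ ^ 2 / u₁ ^ 2) (by positivity), hc (v₀ ^ 2 / v₁ ^ 2) (by positivity),
    inv (z := u₁ ^ 2 * v₀ ^ 2) (by positivity), inv (z := u₁ ^ 2 * v₁ ^ 2) (by positivity)]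
  generalize thetaSeries (q ^ 2) (-a ^ 2) / a = Ka at *
  generalize thetaSeries (q ^ 2) (-b ^ 2) / b = Kb at *
  generalize thetaSeries (q ^ 2) (-c' ^ 2) / c' = Kc at *
  generalize thetaSeries (q ^ 2) (-d ^ 2) / d = Kd at *
  generalize thetaSeries (q ^ 2) (-(q * a) ^ 2) = Fa at *
  generalize thetaSeries (q ^ 2) (-(q * b) ^ 2) = Fb at *
  generalize thetaSeries (q ^ 2) (-(q * c') ^ 2) = Fc at *
  generalize thetaSeries (q ^ 2) (-(q * d) ^ 2) = Fd at *
  have e1 := congrArg₂ (· * ·) k1 k2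
  have e2 := congrArg₂ (· * ·) k3 k4
  have e3 := congrArg₂ (· * ·) k5 k6
  linear_combination c ^ 4 * (-(u₁ ^ 2 * v₀ ^ 2) * e1 + (u₁ ^ 2 * v₁ ^ 2) * e2 -
    (u₁ ^ 2 * v₁ ^ 2) * e3 - a * (Ka * Fb - Fa * Kb) * (Kc * Fd - Fc * Kd) * hbc)

theorem Matrix.det_succ_eq_mul_det_of_ne_zero {K : Type*} [Field K] {n : ℕ}
    (M : Matrix (Fin (n + 1)) (Fin (n + 1)) K) (h : M 0 0 ≠ 0) :
    M.det = M 0 0 * (Matrix.of fun i j : Fin n =>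
      M i.succ j.succ - M i.succ 0 / M 0 0 * M 0 j.succ).det := by
  let c : Fin (n + 1) → K := Fin.cons 0 fun i => M i.succ 0 / M 0 0
  let B : Matrix (Fin (n + 1)) (Fin (n + 1)) K := Matrix.of fun i j => M i j - c i * M 0 j
  have hdet : M.det = B.det :=
    Matrix.det_eq_of_forall_row_eq_smul_add_const c 0 rfl fun i j => by simp [B, c]
  rw [hdet, Matrix.det_succ_column_zero, Fin.sum_univ_succ, Finset.sum_eq_zero]
  · have hsub : B.submatrix (Fin.succAbove 0) Fin.succ = Matrix.of fun i j : Fin n =>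
        M i.succ j.succ - M i.succ 0 / M 0 0 * M 0 j.succ := by
      ext i j
      simp [B, c]
    rw [hsub]
    simp [B, c]
  · intro i _
    have : B i.succ 0 = 0 := by simp [B, c, h]
    simp [this]

/-- The factor of the Frobenius determinant that does not depend on `t`. -/
noncomputable def frobeniusProd (p : ℂ) {n : ℕ} (x y : Fin n → ℂ) : ℂ :=
  (∏ i, ∏ j, if i < j then
    x j * y j * (ellTheta (x i / x j) p * ellTheta (y i / y j) p) else 1) *
    ∏ i, ∏ j, (ellTheta (x i * y j) p)⁻¹

theorem frobeniusProd_succ (p : ℂ) {n : ℕ} (x y : Fin (n + 1) → ℂ) :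
    frobeniusProd p x y =
      (∏ i : Fin n, x i.succ * ellTheta (x 0 / x i.succ) p * (ellTheta (x i.succ * y 0) p)⁻¹) *
      (∏ j : Fin n, y j.succ * ellTheta (y 0 / y j.succ) p * (ellTheta (x 0 * y j.succ) p)⁻¹) *
      (ellTheta (x 0 * y 0) p)⁻¹ *
      frobeniusProd p (fun i => x (Fin.succ i)) fun i => y (Fin.succ i) := by
  simp only [frobeniusProd, Fin.prod_univ_succ, Fin.succ_lt_succ_iff, Fin.succ_pos,
    if_true, if_false, Fin.not_lt_zero, one_mul, Finset.prod_mul_distrib]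
  ring

theorem schur_complement_entry_eq {a b c d e f g k T U V W X Y : ℂ} (hk : k ≠ 0) (hd : d ≠ 0) (hc : c ≠ 0)
    (ha : a ≠ 0)
    (h : a * b * c * d - e * f * g * k = T * U * (X * Y) * (V * W)) :
    b / k - f / d / (a / g) * (e / c) =
      T / a * (X * V * d⁻¹) * (Y * W * c⁻¹ * (U / k)) := by
  field_simp
  linear_combination h

theorem continuousAt_ellTheta {p x : ℂ} (hp0 : p ≠ 0) (hp1 : ‖p‖ < 1) (hx : x ≠ 0) :
    ContinuousAt (fun z => ellTheta z p) x := by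
  obtain ⟨q, rfl⟩ := IsAlgClosed.exists_pow_nat_eq p two_pos
  have hq : q ≠ 0 := by rintro rfl; simp at hp0
  have hq1 : ‖q‖ < 1 := by
    rw [norm_pow] at hp1
    exact (pow_lt_one_iff_of_nonneg (norm_nonneg q) two_ne_zero).1 hp1
  obtain ⟨c, hc⟩ := exists_ellTheta_eq_mul_thetaSeries hq hq1
  refine ((continuousAt_thetaSeries hq hq1 hx).const_mul c).congr ?_
  filter_upwards [isOpen_ne.mem_nhds hx] with z hz using (hc z hz).symm

theorem frobenius_determinant_mul {p : ℂ} (hp0 : p ≠ 0) (hp1 : ‖p‖ < 1) {n : ℕ} {t : ℂ}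
    (ht : t ≠ 0) {x y : Fin n → ℂ} (hx : ∀ i, x i ≠ 0) (hy : ∀ i, y i ≠ 0)
    (hxy : ∀ i j, ellTheta (x i * y j) p ≠ 0) :
    ellTheta t p * Matrix.det (Matrix.of fun i j : Fin n =>
        ellTheta (t * x i * y j) p / ellTheta (x i * y j) p) =
      ellTheta t p ^ n * ellTheta (t * ∏ i, x i * y i) p * frobeniusProd p x y := by
  induction n generalizing t with
  | zero => simp [frobeniusProd]
  | succ n ih =>
    have generic : ∀ t : ℂ, t ≠ 0 → ellTheta (t * x 0 * y 0) p ≠ 0 →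
        Matrix.det (Matrix.of fun i j : Fin (n + 1) =>
          ellTheta (t * x i * y j) p / ellTheta (x i * y j) p) =
        ellTheta t p ^ n * ellTheta (t * ∏ i, x i * y i) p * frobeniusProd p x y := by
      intro t ht h0
      rw [Matrix.det_succ_eq_mul_det_of_ne_zero _ (div_ne_zero h0 (hxy 0 0))]
      have hs : t * (x 0 * y 0) ≠ 0 := mul_ne_zero ht (mul_ne_zero (hx 0) (hy 0))
      have ih' := ih hs (x := fun i => x i.succ) (y := fun i => y i.succ) (fun i => hx _)
        (fun i => hy _) fun i j => hxy _ _
      have hentry : (Matrix.of fun i j : Fin n =>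
          (Matrix.of fun i j : Fin (n + 1) =>
            ellTheta (t * x i * y j) p / ellTheta (x i * y j) p) i.succ j.succ -
          (Matrix.of fun i j : Fin (n + 1) =>
            ellTheta (t * x i * y j) p / ellTheta (x i * y j) p) i.succ 0 /
          (Matrix.of fun i j : Fin (n + 1) =>
            ellTheta (t * x i * y j) p / ellTheta (x i * y j) p) 0 0 *
          (Matrix.of fun i j : Fin (n + 1) =>
            ellTheta (t * x i * y j) p / ellTheta (x i * y j) p) 0 j.succ) =
          Matrix.of fun i j : Fin n =>
            (ellTheta t p / ellTheta (t * (x 0 * y 0)) p *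
              (x i.succ * ellTheta (x 0 / x i.succ) p * (ellTheta (x i.succ * y 0) p)⁻¹)) *
            (Matrix.of fun i j : Fin n =>
              (y j.succ * ellTheta (y 0 / y j.succ) p * (ellTheta (x 0 * y j.succ) p)⁻¹) *
              (Matrix.of fun i j : Fin n =>
                ellTheta (t * (x 0 * y 0) * x i.succ * y j.succ) p /
                  ellTheta (x i.succ * y j.succ) p) i j) i j := by
        ext i j
        simp only [Matrix.of_apply]
        rw [← mul_assoc t (x 0) (y 0)]
        have h := ellTheta_addition hp0 hp1 ht (hx 0) (hx i.succ) (hy 0) (hy j.succ)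
        rw [← mul_assoc t (x 0) (y 0)] at h
        exact schur_complement_entry_eq (hxy i.succ j.succ) (hxy i.succ 0) (hxy 0 j.succ) h0 h
      rw [hentry, Matrix.det_mul_column, Matrix.det_mul_row, Finset.prod_mul_distrib,
        Finset.prod_const, Finset.card_univ, Fintype.card_fin, frobeniusProd_succ,
        Fin.prod_univ_succ (fun i => x i * y i), ← mul_assoc t (x 0 * y 0)]
      simp only [Matrix.of_apply]
      rw [← mul_assoc t (x 0) (y 0)] at ih' ⊢
      rw [div_pow]
      generalize Matrix.det (Matrix.of fun i j : Fin n =>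
        ellTheta (t * x 0 * y 0 * x i.succ * y j.succ) p /
          ellTheta (x i.succ * y j.succ) p) = D at ih' ⊢
      generalize ∏ i : Fin n, x i.succ * ellTheta (x 0 / x i.succ) p *
        (ellTheta (x i.succ * y 0) p)⁻¹ = X
      generalize ∏ j : Fin n, y j.succ * ellTheta (y 0 / y j.succ) p *
        (ellTheta (x 0 * y j.succ) p)⁻¹ = Y
      have hpow := pow_ne_zero n h0
      field_simp
      linear_combination ellTheta t p ^ n * X * Y * (ellTheta (x 0 * y 0) p)⁻¹ * ih'
    have hcont : ∀ z : ℂ, z ≠ 0 → ContinuousAt (fun s => ellTheta (s * z) p) t := fun z hz =>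
      ContinuousAt.comp (f := fun s : ℂ => s * z) (g := fun s => ellTheta s p)
        (continuousAt_ellTheta hp0 hp1 (mul_ne_zero ht hz)) (continuousAt_id.mul_const z)
    have hprod : ∏ i, x i * y i ≠ 0 :=
      Finset.prod_ne_zero_iff.2 fun i _ => mul_ne_zero (hx i) (hy i)
    have hl : ContinuousAt (fun s => Matrix.det (Matrix.of fun i j : Fin (n + 1) =>
        ellTheta (s * x i * y j) p / ellTheta (x i * y j) p)) t := by
      refine ContinuousAt.comp (g := Matrix.det) (continuous_id.matrix_det).continuousAt ?_
      refine continuousAt_pi.2 fun i => continuousAt_pi.2 fun j => ?_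
      simp only [Matrix.of_apply, mul_assoc]
      exact (hcont _ (mul_ne_zero (hx i) (hy j))).div_const _
    have hr : ContinuousAt (fun s => ellTheta s p ^ n * ellTheta (s * ∏ i, x i * y i) p *
        frobeniusProd p x y) t :=
      (((continuousAt_ellTheta hp0 hp1 ht).pow n).mul (hcont _ hprod)).mul_const _
    have hdense : Dense ((fun s : ℂ => s * (x 0 * y 0)) ⁻¹'
        {z : ℂ | z = 0 ∨ ellTheta z p = 0})ᶜ :=
      ((countable_ellTheta_zeros hp1).preimage
        (mul_left_injective₀ (mul_ne_zero (hx 0) (hy 0)))).dense_compl ℂ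
    have hne := mem_closure_iff_nhdsWithin_neBot.1 (hdense t)
    have hev : ∀ᶠ s in 𝓝[((fun s : ℂ => s * (x 0 * y 0)) ⁻¹'
        {z : ℂ | z = 0 ∨ ellTheta z p = 0})ᶜ] t,
        Matrix.det (Matrix.of fun i j : Fin (n + 1) =>
          ellTheta (s * x i * y j) p / ellTheta (x i * y j) p) =
        ellTheta s p ^ n * ellTheta (s * ∏ i, x i * y i) p * frobeniusProd p x y := by
      filter_upwards [self_mem_nhdsWithin] with s hs
      have hs' := not_or.1 hs
      refine generic s (left_ne_zero_of_mul hs'.1) ?_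
      rw [mul_assoc]
      exact hs'.2
    have heq := tendsto_nhds_unique_of_eventuallyEq (hl.tendsto.mono_left nhdsWithin_le_nhds)
      (hr.tendsto.mono_left nhdsWithin_le_nhds) hev
    rw [heq]
    ring

/-- The Frobenius determinant identity. -/
theorem frobenius_determinant (n : ℕ) (hn : 1 ≤ n) (p t : ℂ)
    (hp0 : 0 < ‖p‖) (hp1 : ‖p‖ < 1)
    (ht0 : t ≠ 0) (x y : Fin n → ℂ)
    (hx0 : ∀ i, x i ≠ 0) (hy0 : ∀ i, y i ≠ 0)
    (htne : ellTheta t p ≠ 0)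
    (hxy : ∀ i j, ellTheta (x i * y j) p ≠ 0) :
    Matrix.det (Matrix.of fun i j : Fin n =>
        ellTheta (t * x i * y j) p / (ellTheta t p * ellTheta (x i * y j) p)) =
      ellTheta (t * ∏ i, x i * y i) p / ellTheta t p *
        (∏ i, ∏ j, if i < j then
          x j * y j * (ellTheta (x i / x j) p * ellTheta (y i / y j) p) else 1) *
        ∏ i, ∏ j, (ellTheta (x i * y j) p)⁻¹ := by
  have h := frobenius_determinant_mul (norm_pos_iff.1 hp0) hp1 ht0 hx0 hy0 hxy
  have hdet : (Matrix.of fun i j : Fin n =>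
      ellTheta (t * x i * y j) p / (ellTheta t p * ellTheta (x i * y j) p)) =
      (ellTheta t p)⁻¹ • Matrix.of fun i j : Fin n =>
        ellTheta (t * x i * y j) p / ellTheta (x i * y j) p := by
    ext i j
    simp only [Matrix.of_apply, Matrix.smul_apply, smul_eq_mul]
    have := hxy i j
    field_simp
  rw [hdet, Matrix.det_smul, Fintype.card_fin, mul_assoc, ← frobeniusProd, inv_pow,
    inv_mul_eq_iff_eq_mul₀ (pow_ne_zero n htne), div_mul_eq_mul_div, ← mul_div_assoc,
    eq_div_iff htne, ← mul_assoc, ← h, mul_comm]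
end

section
/- Let n ≥ 1 be an integer, let p ∈ ℂ with 0 < |p| < 1, and let v, w, q_1, ..., q_n, z_1, ..., z_n ∈ ℂ, all nonzero, with v w ∏_{i=1}^{n} q_i² = 1. Assume θ(z_i²;p) ≠ 0 for all i, and θ(z_i z_j;p) ≠ 0 and θ(z_i/z_j;p) ≠ 0 for all i < j. Then Σ_{σ ∈ {±1}^n} ∏_{i=1}^{n} θ(v q_i z_i^{σ_i};p) θ(w q_i z_i^{σ_i};p)/θ(z_i^{2σ_i};p) · ∏_{1≤i<j≤n} q_j^{−1} θ(q_i q_j z_i^{σ_i} z_j^{σ_j};p) θ(q_j z_i^{σ_i}/(q_i z_j^{σ_j});p) / ( θ(z_i^{σ_i} z_j^{σ_j};p) θ(z_i^{σ_i}/z_j^{σ_j};p) ) = 0. -/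
open scoped BigOperators Real

section HomogeneousForms

variable {ι τ : Type*} (𝒯 : Finset τ) (S : Finset ι) (c : τ → ℂ) (α β : τ → ι → ℂ)

/-- The binary form `∑ T, c T ∏ i, (α T i * a + β T i * b)` of degree `#S`. -/
noncomputable def linearProductForm (a b : ℂ) : ℂ :=
  ∑ T ∈ 𝒯, c T * ∏ i ∈ S, (α T i * a + β T i * b)

lemma linearProductForm_smul (r a b : ℂ) :
    linearProductForm 𝒯 S c α β (r * a) (r * b) =
      r ^ S.card * linearProductForm 𝒯 S c α β a b := by
  unfold linearProductForm
  rw [Finset.mul_sum]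
  refine Finset.sum_congr rfl fun T _ => ?_
  rw [← Finset.prod_const, mul_left_comm, ← Finset.prod_mul_distrib]
  congr 1
  refine Finset.prod_congr rfl fun i _ => ?_
  ring

/-- A binary form vanishing at `#S + 2` pairwise non-proportional points vanishes. -/
lemma linearProductForm_eq_zero {κ : Type*} (K : Finset κ) (P Q : κ → ℂ)
    (hcard : S.card + 2 ≤ K.card)
    (hK : ∀ k ∈ K, ∀ l ∈ K, k ≠ l → P k * Q l - Q k * P l ≠ 0)
    (h0 : ∀ k ∈ K, linearProductForm 𝒯 S c α β (P k) (Q k) = 0) (a b : ℂ) :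
    linearProductForm 𝒯 S c α β a b = 0 := by
  classical
  obtain ⟨k₀, hk₀, k₁, hk₁, hne⟩ := Finset.one_lt_card.1 (show 1 < K.card by omega)
  have key : ∀ k ∈ K, k ≠ k₀ →
      linearProductForm 𝒯 S c α β (a + (a * Q k - b * P k) / (P k * Q k₀ - Q k * P k₀) * P k₀)
        (b + (a * Q k - b * P k) / (P k * Q k₀ - Q k * P k₀) * Q k₀) = 0 := by
    intro k hk hkk
    have hD := hK k hk k₀ hk₀ hkk
    have h1 := linearProductForm_smul 𝒯 S c α β (P k * Q k₀ - Q k * P k₀)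
      (a + (a * Q k - b * P k) / (P k * Q k₀ - Q k * P k₀) * P k₀)
      (b + (a * Q k - b * P k) / (P k * Q k₀ - Q k * P k₀) * Q k₀)
    have h2 := linearProductForm_smul 𝒯 S c α β (a * Q k₀ - b * P k₀) (P k) (Q k)
    rw [h0 k hk, mul_zero] at h2
    have e1 : (P k * Q k₀ - Q k * P k₀) *
        (a + (a * Q k - b * P k) / (P k * Q k₀ - Q k * P k₀) * P k₀)
        = (a * Q k₀ - b * P k₀) * P k := by field_simp; ring
    have e2 : (P k * Q k₀ - Q k * P k₀) *
        (b + (a * Q k - b * P k) / (P k * Q k₀ - Q k * P k₀) * Q k₀)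
        = (a * Q k₀ - b * P k₀) * Q k := by field_simp; ring
    rw [e1, e2, h2] at h1
    exact (mul_eq_zero.1 h1.symm).resolve_left (pow_ne_zero _ hD)
  by_cases hab : a * Q k₀ - b * P k₀ = 0
  · have hD := hK k₁ hk₁ k₀ hk₀ hne.symm
    have h1 := linearProductForm_smul 𝒯 S c α β (P k₁ * Q k₀ - Q k₁ * P k₀) a b
    have h2 := linearProductForm_smul 𝒯 S c α β (b * P k₁ - a * Q k₁) (P k₀) (Q k₀)
    rw [h0 k₀ hk₀, mul_zero] at h2
    have e1 : (P k₁ * Q k₀ - Q k₁ * P k₀) * a = (b * P k₁ - a * Q k₁) * P k₀ := by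
      linear_combination P k₁ * hab
    have e2 : (P k₁ * Q k₀ - Q k₁ * P k₀) * b = (b * P k₁ - a * Q k₁) * Q k₀ := by
      linear_combination Q k₁ * hab
    rw [e1, e2, h2] at h1
    exact (mul_eq_zero.1 h1.symm).resolve_left (pow_ne_zero _ hD)
  · let h : Polynomial ℂ := ∑ T ∈ 𝒯, Polynomial.C (c T) *
      ∏ i ∈ S, (Polynomial.C (α T i * P k₀ + β T i * Q k₀) * Polynomial.X +
        Polynomial.C (α T i * a + β T i * b))
    have heval : ∀ t, h.eval t =
        linearProductForm 𝒯 S c α β (a + t * P k₀) (b + t * Q k₀) := by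
      intro t
      simp only [h, linearProductForm, Polynomial.eval_finsetSum, Polynomial.eval_mul,
        Polynomial.eval_prod, Polynomial.eval_add, Polynomial.eval_C, Polynomial.eval_X]
      refine Finset.sum_congr rfl fun T _ => ?_
      congr 1
      refine Finset.prod_congr rfl fun i _ => ?_
      ring
    have hdeg : h.natDegree ≤ S.card := by
      refine Polynomial.natDegree_sum_le_of_forall_le _ _ fun T _ => ?_
      refine (Polynomial.natDegree_C_mul_le _ _).trans ((Polynomial.natDegree_prod_le _ _).trans ?_)
      refine (Finset.sum_le_card_nsmul S _ 1 fun i _ => Polynomial.natDegree_linear_le).trans ?_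
      simp
    have hzero : h = 0 := by
      refine Polynomial.eq_zero_of_natDegree_lt_card_of_eval_eq_zero' h
        ((K.erase k₀).image fun k => (a * Q k - b * P k) / (P k * Q k₀ - Q k * P k₀)) ?_ ?_
      · intro t ht
        obtain ⟨k, hk, rfl⟩ := Finset.mem_image.1 ht
        rw [heval]
        exact key k (Finset.mem_of_mem_erase hk) (Finset.ne_of_mem_erase hk)
      · rw [Finset.card_image_of_injOn, Finset.card_erase_of_mem hk₀]
        · omega
        · intro k hk l hl hkl
          simp only [Finset.coe_erase, Set.mem_sdiff, Finset.mem_coe,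
            Set.mem_singleton_iff] at hk hl
          by_contra hne'
          have hk' := hK k hk.1 k₀ hk₀ hk.2
          have hl' := hK l hl.1 k₀ hk₀ hl.2
          have hkl' := hK k hk.1 l hl.1 hne'
          have hkl2 := (div_eq_div_iff hk' hl').1 hkl
          refine mul_ne_zero hab hkl' ?_
          linear_combination -hkl2
    have := heval 0
    simpa [hzero] using this.symm

end HomogeneousForms

/-- The value `x i` or `y i`. -/
def choice {ι : Type*} (x y : ι → ℂ) (k : ι × Bool) : ℂ := if k.2 then y k.1 else x k.1

lemma choice_add_mul {ι : Type*} (x y ξ η : ι → ℂ) (t : ℂ) (k : ι × Bool) :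
    choice (fun i => x i + t * ξ i) (fun i => y i + t * η i) k =
      choice x y k + t * choice ξ η k := by
  unfold choice
  split_ifs <;> rfl

lemma sum_choice {ι : Type*} (S : Finset ι) (x y : ι → ℂ) :
    ∑ k ∈ S ×ˢ (Finset.univ : Finset Bool), choice x y k = ∑ i ∈ S, (x i + y i) := by
  rw [Finset.sum_product]
  refine Finset.sum_congr rfl fun i _ => ?_
  simp [choice, add_comm]

section SignedSum

variable {ι : Type*} [LinearOrder ι]

/-- The family `x` with its entries at the indices in `T` replaced by those of `y`. -/
def swapOn (x y : ι → ℂ) (T : Finset ι) (i : ι) : ℂ := if i ∈ T then y i else x i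

/-- The product over pairs of indices of `S` occurring in `signedSum`. -/
def pairProd (s : ℂ → ℂ) (S : Finset ι) (X Y : ι → ℂ) : ℂ :=
  ∏ i ∈ S, ∏ j ∈ S, if i < j then s (X i + X j) * s (Y j - Y i) else 1

/-- The signed sum over all ways of interchanging `x i` and `y i`. -/
def signedSum (s : ℂ → ℂ) (S : Finset ι) (x y : ι → ℂ) (v w : ℂ) : ℂ :=
  ∑ T ∈ S.powerset, (-1) ^ T.card *
    ((∏ i ∈ S, s (v + swapOn x y T i) * s (w + swapOn x y T i)) *
      pairProd s S (swapOn x y T) (swapOn y x T))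

/-- The part of `signedSum` over `insert a S` with a fixed choice `α` at `a`. -/
def pinnedSum (s : ℂ → ℂ) (S : Finset ι) (x y : ι → ℂ) (v w : ℂ) (a : ι) (α β : ℂ) : ℂ :=
  s (v + α) * s (w + α) * ∑ T ∈ S.powerset, (-1) ^ T.card *
    ((∏ i ∈ S, s (v + swapOn x y T i) * s (w + swapOn x y T i)) *
      ((∏ j ∈ S, (if a < j then 1 else -1) *
          (s (α + swapOn x y T j) * s (swapOn y x T j - β))) *
        pairProd s S (swapOn x y T) (swapOn y x T)))

lemma pairProd_congr {s : ℂ → ℂ} {S : Finset ι} {X Y X' Y' : ι → ℂ}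
    (hX : ∀ i ∈ S, X i = X' i) (hY : ∀ i ∈ S, Y i = Y' i) :
    pairProd s S X Y = pairProd s S X' Y' := by
  unfold pairProd
  refine Finset.prod_congr rfl fun i hi => Finset.prod_congr rfl fun j hj => ?_
  rw [hX i hi, hX j hj, hY i hi, hY j hj]

lemma pairProd_insert {s : ℂ → ℂ} (hodd : ∀ a, s (-a) = -s a) {S : Finset ι} {a : ι}
    (ha : a ∉ S) (X Y : ι → ℂ) :
    pairProd s (insert a S) X Y =
      (∏ j ∈ S, (if a < j then 1 else -1) * (s (X a + X j) * s (Y j - Y a))) *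
        pairProd s S X Y := by
  unfold pairProd
  rw [Finset.prod_insert ha, Finset.prod_insert ha]
  simp only [lt_irrefl, if_false, one_mul, Finset.prod_insert ha]
  rw [Finset.prod_mul_distrib, ← mul_assoc, ← Finset.prod_mul_distrib]
  congr 1
  refine Finset.prod_congr rfl fun j hj => ?_
  have hne : a ≠ j := fun h => ha (h ▸ hj)
  rcases lt_or_gt_of_ne hne with h | h
  · simp [h, h.not_gt]
  · rw [if_neg h.not_gt, if_pos h, if_neg h.not_gt, ← neg_sub (Y j) (Y a), hodd,
      add_comm (X j)]
    ring

lemma signedSum_insert {s : ℂ → ℂ} (hodd : ∀ a, s (-a) = -s a) {S : Finset ι} {a : ι}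
    (ha : a ∉ S) (x y : ι → ℂ) (v w : ℂ) :
    signedSum s (insert a S) x y v w =
      pinnedSum s S x y v w a (x a) (y a) - pinnedSum s S x y v w a (y a) (x a) := by
  unfold signedSum pinnedSum
  rw [Finset.sum_powerset_insert ha, sub_eq_add_neg, Finset.mul_sum, Finset.mul_sum,
    ← Finset.sum_neg_distrib]
  congr 1
  · refine Finset.sum_congr rfl fun T hT => ?_
    have haT : a ∉ T := fun h => ha (Finset.mem_powerset.1 hT h)
    rw [Finset.prod_insert ha, pairProd_insert hodd ha]
    simp only [show swapOn x y T a = x a from if_neg haT,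
      show swapOn y x T a = y a from if_neg haT]
    ring
  · refine Finset.sum_congr rfl fun T hT => ?_
    have haT : a ∉ T := fun h => ha (Finset.mem_powerset.1 hT h)
    have hsw : ∀ (x y : ι → ℂ), ∀ i ∈ S, swapOn x y (insert a T) i = swapOn x y T i := by
      intro x y i hi
      have : i ≠ a := fun h => ha (h ▸ hi)
      simp [swapOn, this]
    have hsa : ∀ (x y : ι → ℂ), swapOn x y (insert a T) a = y a := by
      intro x y; simp [swapOn]
    have e1 : ∏ i ∈ S, s (v + swapOn x y (insert a T) i) * s (w + swapOn x y (insert a T) i) =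
        ∏ i ∈ S, s (v + swapOn x y T i) * s (w + swapOn x y T i) :=
      Finset.prod_congr rfl fun i hi => by rw [hsw x y i hi]
    have e2 : ∏ j ∈ S, (if a < j then 1 else -1) *
          (s (y a + swapOn x y (insert a T) j) * s (swapOn y x (insert a T) j - x a)) =
        ∏ j ∈ S, (if a < j then 1 else -1) *
          (s (y a + swapOn x y T j) * s (swapOn y x T j - x a)) :=
      Finset.prod_congr rfl fun i hi => by rw [hsw x y i hi, hsw y x i hi]
    rw [Finset.prod_insert ha, pairProd_insert hodd ha, Finset.card_insert_of_notMem haT,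
      pairProd_congr (hsw x y) (hsw y x), hsa, hsa, e1, e2]
    ring

lemma pinnedSum_eq_mul_signedSum (s : ℂ → ℂ) (S : Finset ι) (x y : ι → ℂ) (w : ℂ) (a : ι)
    (α β : ℂ) :
    pinnedSum s S x y (-β) w a α β =
      s (-β + α) * s (w + α) * (∏ j ∈ S, (if a < j then 1 else -1) *
        (s (x j - β) * s (y j - β))) * signedSum s S x y α w := by
  unfold pinnedSum signedSum
  rw [mul_assoc (s (-β + α) * s (w + α)), Finset.mul_sum _ _ (∏ j ∈ S, _)]
  congr 1
  refine Finset.sum_congr rfl fun T _ => ?_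
  rw [mul_left_comm (∏ j ∈ S, (if a < j then 1 else -1) * (s (x j - β) * s (y j - β)))]
  congr 1
  rw [← mul_assoc, ← mul_assoc, ← Finset.prod_mul_distrib, ← Finset.prod_mul_distrib]
  congr 1
  refine Finset.prod_congr rfl fun j _ => ?_
  by_cases h : j ∈ T
  · simp only [swapOn, h, if_true]
    rw [neg_add_eq_sub]; ring
  · simp only [swapOn, h, if_false]
    rw [neg_add_eq_sub]; ring

lemma odd_zero {s : ℂ → ℂ} (hodd : ∀ a, s (-a) = -s a) : s 0 = 0 := by
  have := hodd 0
  rw [neg_zero] at this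
  exact self_eq_neg.1 this

lemma signedSum_singleton {s : ℂ → ℂ} (hodd : ∀ a, s (-a) = -s a) (a : ι) (x y : ι → ℂ) (v w : ℂ)
    (h : v + w + (x a + y a) = 0) :
    signedSum s {a} x y v w = 0 := by
  have := signedSum_insert hodd (Finset.notMem_empty a) x y v w
  rw [insert_empty_eq] at this
  rw [this]
  simp only [pinnedSum, Finset.powerset_empty, Finset.sum_singleton, Finset.card_empty,
    Finset.prod_empty, pairProd, pow_zero, mul_one]
  rw [show w + x a = -(v + y a) by linear_combination h,
    show w + y a = -(v + x a) by linear_combination h, hodd, hodd]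
  ring

/-- Specializing `v` to `-x i` or `-y i` reduces the sum to one with fewer variables. -/
lemma signedSum_eq_zero_of_choice {s : ℂ → ℂ} (hodd : ∀ a, s (-a) = -s a)
    {S : Finset ι} (x y : ι → ℂ) (w : ℂ) (k : ι × Bool)
    (hk : k.1 ∈ S) (hbal : -choice x y k + w + ∑ i ∈ S, (x i + y i) = 0)
    (ih : ∀ v, v + w + ∑ i ∈ S.erase k.1, (x i + y i) = 0 →
      signedSum s (S.erase k.1) x y v w = 0) :
    signedSum s S x y (-choice x y k) w = 0 := by
  rw [← Finset.add_sum_erase S _ hk] at hbal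
  have h0 : ∀ a α β, pinnedSum s (S.erase k.1) x y (-α) w a α β = 0 := by
    intro a α β
    simp [pinnedSum, odd_zero hodd]
  nth_rewrite 1 [← Finset.insert_erase hk]
  rw [signedSum_insert hodd (Finset.notMem_erase _ _)]
  obtain ⟨i, b⟩ := k
  cases b
  · simp only [choice, Bool.false_eq_true, if_false] at *
    rw [h0, pinnedSum_eq_mul_signedSum, ih _ (by linear_combination hbal)]
    ring
  · simp only [choice, if_true] at *
    rw [h0, pinnedSum_eq_mul_signedSum, ih _ (by linear_combination hbal)]
    ring

lemma det_ne_zero_of_rank_two {s : ℂ → ℂ} (hodd : ∀ a, s (-a) = -s a) {A₀ A₁ B₀ B₁ : ℂ → ℂ}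
    (hrank : ∀ a b, s (a + b) * s (a - b) = A₀ a * B₀ b + A₁ a * B₁ b)
    {a b : ℂ} (h1 : s (a + b) ≠ 0) (h2 : s (a - b) ≠ 0) :
    B₀ a * B₁ b - B₁ a * B₀ b ≠ 0 := by
  intro hD
  have haa := hrank a a
  have hab := hrank a b
  have hba := hrank b a
  rw [sub_self, odd_zero hodd, mul_zero] at haa
  rw [← neg_sub a b, hodd, add_comm b a] at hba
  have h := mul_ne_zero h1 h2
  have hB0 : B₀ a = 0 := by
    refine (mul_eq_zero.1 (?_ : (s (a + b) * s (a - b)) * B₀ a = 0)).resolve_left h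
    rw [hab]; linear_combination A₁ a * hD - B₀ b * haa
  have hB1 : B₁ a = 0 := by
    refine (mul_eq_zero.1 (?_ : (s (a + b) * s (a - b)) * B₁ a = 0)).resolve_left h
    rw [hab]; linear_combination -A₀ a * hD - B₁ b * haa
  rw [hB0, hB1] at hba
  apply h
  linear_combination -hba

lemma signedSum_eq_zero_of_generic {s : ℂ → ℂ} (hodd : ∀ a, s (-a) = -s a) {A₀ A₁ B₀ B₁ : ℂ → ℂ}
    (hrank : ∀ a b, s (a + b) * s (a - b) = A₀ a * B₀ b + A₁ a * B₁ b)
    {S : Finset ι} (hS : 2 ≤ S.card) (x y : ι → ℂ) (v w : ℂ)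
    (hbal : v + w + ∑ i ∈ S, (x i + y i) = 0)
    (ih : ∀ i ∈ S, ∀ v w, v + w + ∑ j ∈ S.erase i, (x j + y j) = 0 →
      signedSum s (S.erase i) x y v w = 0)
    (hgen : ∀ k ∈ S ×ˢ (Finset.univ : Finset Bool), ∀ l ∈ S ×ˢ (Finset.univ : Finset Bool),
      k ≠ l → s (choice x y l - choice x y k) ≠ 0 ∧
        s (∑ i ∈ S, (x i + y i) - choice x y k - choice x y l) ≠ 0) :
    signedSum s S x y v w = 0 := by
  set σ := ∑ i ∈ S, (x i + y i)
  have hform : ∀ v w, v + w + σ = 0 → signedSum s S x y v w =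
      linearProductForm S.powerset S
        (fun T => (-1) ^ T.card * pairProd s S (swapOn x y T) (swapOn y x T))
        (fun T i => A₀ (swapOn x y T i - σ / 2)) (fun T i => A₁ (swapOn x y T i - σ / 2))
        (B₀ (v + σ / 2)) (B₁ (v + σ / 2)) := by
    intro v w h
    refine Finset.sum_congr rfl fun T _ => ?_
    rw [mul_assoc, mul_comm (pairProd _ _ _ _)]
    congr 2
    refine Finset.prod_congr rfl fun i _ => ?_
    rw [← hrank]
    congr 2
    · ring
    · linear_combination h
  rw [hform v w hbal]
  refine linearProductForm_eq_zero _ _ _ _ _ (S ×ˢ (Finset.univ : Finset Bool))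
    (fun k => B₀ (-choice x y k + σ / 2)) (fun k => B₁ (-choice x y k + σ / 2)) ?_ ?_ ?_ _ _
  · rw [Finset.card_product, Finset.card_univ, Fintype.card_bool]; omega
  · intro k hk l hl hkl
    obtain ⟨h1, h2⟩ := hgen k hk l hl hkl
    refine det_ne_zero_of_rank_two hodd hrank ?_ ?_
    · convert h2 using 2; ring
    · convert h1 using 2; ring
  · intro k hk
    have hk1 := (Finset.mem_product.1 hk).1
    have hb : -choice x y k + (choice x y k - σ) + σ = 0 := by ring
    rw [← hform _ (choice x y k - σ) hb]
    exact signedSum_eq_zero_of_choice hodd x y _ k hk1 hb fun v hv => ih _ hk1 v _ hv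

lemma Differentiable.eventually_comp_line_ne_zero {s : ℂ → ℂ} (hs : Differentiable ℂ s)
    (hne : ∃ a, s a ≠ 0) (c : ℂ) {b : ℂ} (hb : b ≠ 0) :
    ∀ᶠ t in nhdsWithin (0 : ℂ) {0}ᶜ, s (c + t * b) ≠ 0 := by
  have hd : Differentiable ℂ fun t => s (c + t * b) := by fun_prop
  have han : AnalyticOnNhd ℂ (fun t => s (c + t * b)) Set.univ := fun t _ => hd.analyticAt t
  rcases (han 0 trivial).eventually_eq_zero_or_eventually_ne_zero with h | h
  · obtain ⟨a, ha⟩ := hne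
    have h0 := han.eqOn_zero_of_preconnected_of_eventuallyEq_zero isPreconnected_univ trivial h
    have := h0 (Set.mem_univ ((a - c) / b))
    simp only [Pi.zero_apply] at this
    rw [div_mul_cancel₀ _ hb, add_sub_cancel] at this
    exact absurd this ha
  · exact h

lemma continuous_swapOn (x y ξ η : ι → ℂ) (T : Finset ι) (i : ι) :
    Continuous fun t : ℂ =>
      swapOn (fun i => x i + t * ξ i) (fun i => y i + t * η i) T i := by
  unfold swapOn
  split_ifs <;> fun_prop

lemma continuous_signedSum {s : ℂ → ℂ} (hs : Continuous s) (S : Finset ι) (x y ξ η : ι → ℂ)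
    (v w b : ℂ) :
    Continuous fun t : ℂ => signedSum s S (fun i => x i + t * ξ i)
      (fun i => y i + t * η i) v (w - t * b) := by
  have hX := continuous_swapOn x y ξ η
  have hY := continuous_swapOn y x η ξ
  unfold signedSum pairProd
  refine continuous_finsetSum _ fun T _ => continuous_const.mul (Continuous.mul ?_ ?_)
  · refine continuous_finsetProd _ fun i _ => ?_
    have := hX T i
    fun_prop
  · refine continuous_finsetProd _ fun i _ => continuous_finsetProd _ fun j _ => ?_
    have h1 := hX T i
    have h2 := hX T j
    have h3 := hY T i
    have h4 := hY T j
    split_ifs <;> fun_prop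

/-- Distinct positive weights on the index set of the variables `x i`, `y i`. -/
def weight {N : ℕ} (k : Fin N × Bool) : ℕ := 2 * k.1 + (if k.2 then 2 else 1)

lemma weight_injective {N : ℕ} : Function.Injective (weight (N := N)) := by
  rintro ⟨i, b⟩ ⟨j, c⟩ h
  simp only [weight] at h
  cases b <;> cases c <;> simp_all [Fin.ext_iff] <;> omega

lemma weight_add_weight_lt {N : ℕ} {K : Finset (Fin N × Bool)} (hK : 2 < K.card)
    {k l : Fin N × Bool} (hk : k ∈ K) (hl : l ∈ K) (hkl : k ≠ l) :
    weight k + weight l < ∑ m ∈ K, weight m := by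
  rw [← Finset.add_sum_erase K _ hk,
    ← Finset.add_sum_erase _ _ (Finset.mem_erase.2 ⟨hkl.symm, hl⟩)]
  have : 0 < ∑ m ∈ (K.erase k).erase l, weight m := by
    refine Finset.sum_pos (fun m _ => ?_) (Finset.card_pos.1 ?_)
    · unfold weight; split_ifs <;> omega
    · rw [Finset.card_erase_of_mem (Finset.mem_erase.2 ⟨hkl.symm, hl⟩),
        Finset.card_erase_of_mem hk]
      omega
  omega

/-- The vanishing of `signedSum` for an odd entire function `s` for which
`s (a + b) * s (a - b)` has rank two. -/
theorem signedSum_eq_zero {N : ℕ} {s : ℂ → ℂ} (hodd : ∀ a, s (-a) = -s a)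
    {A₀ A₁ B₀ B₁ : ℂ → ℂ}
    (hrank : ∀ a b, s (a + b) * s (a - b) = A₀ a * B₀ b + A₁ a * B₁ b)
    (hs : Differentiable ℂ s) (m : ℕ) (S : Finset (Fin N)) (hS : S.card = m + 1)
    (x y : Fin N → ℂ) (v w : ℂ) (hbal : v + w + ∑ i ∈ S, (x i + y i) = 0) :
    signedSum s S x y v w = 0 := by
  by_cases hne : ∃ a, s a ≠ 0
  swap
  · push Not at hne
    obtain ⟨a, ha⟩ := Finset.card_pos.1 (show 0 < S.card by omega)
    refine Finset.sum_eq_zero fun T _ => ?_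
    rw [Finset.prod_eq_zero ha (by rw [hne, zero_mul])]
    ring
  induction m generalizing S x y v w with
  | zero =>
    obtain ⟨a, rfl⟩ := Finset.card_eq_one.1 hS
    rw [Finset.sum_singleton] at hbal
    exact signedSum_singleton hodd a x y v w hbal
  | succ m ih =>
    set ξ : Fin N → ℂ := fun i => (weight (i, false) : ℂ)
    set η : Fin N → ℂ := fun i => (weight (i, true) : ℂ)
    set b := ∑ i ∈ S, (ξ i + η i) with hb
    have hch : ∀ k, choice ξ η k = (weight k : ℂ) := by
      rintro ⟨i, _ | _⟩ <;> rfl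
    have hsum : ∀ t : ℂ, ∑ i ∈ S, ((x i + t * ξ i) + (y i + t * η i)) =
        ∑ i ∈ S, (x i + y i) + t * b := by
      intro t
      rw [hb, Finset.mul_sum, ← Finset.sum_add_distrib]
      exact Finset.sum_congr rfl fun i _ => by ring
    have hbK : b = ((∑ k ∈ S ×ˢ (Finset.univ : Finset Bool), weight k : ℕ) : ℂ) := by
      rw [hb, ← sum_choice, Nat.cast_sum]
      exact Finset.sum_congr rfl fun k _ => hch k
    have hcard : 2 < (S ×ˢ (Finset.univ : Finset Bool)).card := by
      rw [Finset.card_product, Finset.card_univ, Fintype.card_bool]; omega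
    have hev : ∀ᶠ t in nhdsWithin (0 : ℂ) {0}ᶜ,
        signedSum s S (fun i => x i + t * ξ i) (fun i => y i + t * η i) v (w - t * b) = 0 := by
      have hgen : ∀ᶠ t in nhdsWithin (0 : ℂ) {0}ᶜ,
          ∀ k ∈ S ×ˢ (Finset.univ : Finset Bool), ∀ l ∈ S ×ˢ (Finset.univ : Finset Bool),
            k ≠ l → s (choice x y l - choice x y k + t * (weight l - weight k)) ≠ 0 ∧
              s (∑ i ∈ S, (x i + y i) - choice x y k - choice x y l +
                t * (b - weight k - weight l)) ≠ 0 := by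
        rw [Filter.eventually_all_finset]
        intro k hk
        rw [Filter.eventually_all_finset]
        intro l hl
        by_cases hkl : k = l
        · exact Filter.Eventually.of_forall fun t h => absurd hkl h
        · have h1 : (weight l : ℂ) - weight k ≠ 0 := by
            rw [sub_ne_zero, Nat.cast_injective.ne_iff]
            exact weight_injective.ne (Ne.symm hkl)
          have h2 : b - weight k - weight l ≠ 0 := by
            have := weight_add_weight_lt hcard hk hl hkl
            rw [sub_sub, sub_ne_zero, hbK, ← Nat.cast_add, Nat.cast_injective.ne_iff]
            exact this.ne'
          filter_upwards [hs.eventually_comp_line_ne_zero hne _ h1,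
            hs.eventually_comp_line_ne_zero hne _ h2] with t ht1 ht2 _
          exact ⟨ht1, ht2⟩
      filter_upwards [hgen] with t ht
      refine signedSum_eq_zero_of_generic hodd hrank (by omega) _ _ _ _ ?_ ?_ ?_
      · rw [hsum]; linear_combination hbal
      · intro i hi v w hvw
        exact ih _ (by rw [Finset.card_erase_of_mem hi]; omega) _ _ _ _ hvw
      · intro k hk l hl hkl
        obtain ⟨h1, h2⟩ := ht k hk l hl hkl
        rw [hsum, choice_add_mul, choice_add_mul, hch, hch]
        constructor
        · convert h1 using 2; ring
        · convert h2 using 2; ring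
    have hcont := continuous_signedSum hs.continuous S x y ξ η v w b
    have hlim := (hcont.tendsto 0).mono_left (nhdsWithin_le_nhds (s := {0}ᶜ))
    have := tendsto_nhds_unique (hlim.congr' hev) tendsto_const_nhds
    simpa using this

end SignedSum

section TripleProduct

open Filter Topology

variable {p : ℂ}

/-- The finite product `(p;p)_m`. -/
noncomputable def eulerProd (p : ℂ) (m : ℕ) : ℂ := ∏ j ∈ Finset.range m, (1 - p ^ (j + 1))

/-- The reciprocal of `(p;p)_m`, extended by `0` to negative `m`. -/
noncomputable def eulerProdInv (p : ℂ) (m : ℤ) : ℂ :=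
  if m < 0 then 0 else (eulerProd p m.toNat)⁻¹

lemma one_sub_pow_succ_ne_zero (hp1 : ‖p‖ < 1) (j : ℕ) : 1 - p ^ (j + 1) ≠ 0 := by
  intro h
  have h1 : ‖p ^ (j + 1)‖ = 1 := by rw [← sub_eq_zero.1 h, norm_one]
  rw [norm_pow] at h1
  exact (pow_lt_one₀ (norm_nonneg p) hp1 j.succ_ne_zero).ne h1

lemma eulerProd_ne_zero (hp1 : ‖p‖ < 1) (m : ℕ) : eulerProd p m ≠ 0 :=
  Finset.prod_ne_zero_iff.2 fun j _ => one_sub_pow_succ_ne_zero hp1 j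

lemma eulerProdInv_sub_one (hp1 : ‖p‖ < 1) (m : ℤ) :
    eulerProdInv p (m - 1) = (1 - p ^ m) * eulerProdInv p m := by
  unfold eulerProdInv
  rcases lt_trichotomy m 0 with h | rfl | h
  · rw [if_pos h, if_pos (by omega), mul_zero]
  · simp
  · obtain ⟨k, rfl⟩ : ∃ k : ℕ, m = (k + 1 : ℕ) := ⟨(m - 1).toNat, by omega⟩
    rw [if_neg (by omega), if_neg (by omega), Int.toNat_natCast, zpow_natCast,
      show (((k + 1 : ℕ) : ℤ) - 1).toNat = k by omega]
    have h1 := eulerProd_ne_zero hp1 k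
    have h2 := one_sub_pow_succ_ne_zero hp1 k
    unfold eulerProd at *
    rw [Finset.prod_range_succ]
    field_simp

/-- The finite form of the Jacobi triple product identity. -/
lemma hasSum_finite_triple_product (hp : p ≠ 0) (hp1 : ‖p‖ < 1) {x : ℂ} (hx : x ≠ 0)
    {u : ℤ → ℂ} (hu0 : u 0 = 1) (hu : ∀ j, u (j + 1) = -x * p ^ j * u j) (N : ℕ) :
    HasSum (fun j : ℤ => eulerProd p (2 * N) * eulerProdInv p (N + j) *
        eulerProdInv p (N - j) * u j)
      (∏ k ∈ Finset.range N, ((1 - p ^ k * x) * (1 - p ^ (k + 1) / x))) := by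
  induction N with
  | zero =>
    convert hasSum_single (0 : ℤ) ?_ using 1
    · simp [eulerProd, eulerProdInv, hu0]
    · intro j hj
      rcases lt_or_gt_of_ne hj with h | h
      · simp [eulerProdInv, h]
      · simp [eulerProdInv, h]
  | succ N ih =>
    have h1 := (Equiv.subRight (1 : ℤ)).hasSum_iff.2 ih
    have h2 := (Equiv.addRight (1 : ℤ)).hasSum_iff.2 ih
    have h3 := ((ih.mul_left (1 + p ^ (2 * N + 1))).sub (h1.mul_left (p ^ N * x))).sub
      (h2.mul_left (p ^ (N + 1) / x))
    refine Eq.mp (congrArg₂ (fun f P => HasSum f P) ?_ ?_) h3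
    · symm
      funext j
      simp only [Function.comp_apply, Equiv.subRight_apply, Equiv.coe_addRight]
      have hu1 : u j = -x * p ^ (j - 1) * u (j - 1) := by
        have := hu (j - 1)
        rwa [sub_add_cancel] at this
      set r := eulerProdInv p (N + 1 + j) with hr
      set q := eulerProdInv p (N + 1 - j) with hq
      have e1 : eulerProdInv p (N + j) = (1 - p ^ (N + 1 + j : ℤ)) * r := by
        rw [hr, ← eulerProdInv_sub_one hp1]; congr 1; ring
      have e2 : eulerProdInv p (N - j) = (1 - p ^ (N + 1 - j : ℤ)) * q := by
        rw [hq, ← eulerProdInv_sub_one hp1]; congr 1; ring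
      have e3 : eulerProdInv p (N + (j - 1)) =
          (1 - p ^ (N + j : ℤ)) * ((1 - p ^ (N + 1 + j : ℤ)) * r) := by
        rw [← e1, ← eulerProdInv_sub_one hp1]; congr 1; ring
      have e4 : eulerProdInv p (N - (j + 1)) =
          (1 - p ^ (N - j : ℤ)) * ((1 - p ^ (N + 1 - j : ℤ)) * q) := by
        rw [← e2, ← eulerProdInv_sub_one hp1]; congr 1; ring
      have e5 : eulerProd p (2 * (N + 1)) =
          eulerProd p (2 * N) * (1 - p ^ (2 * N + 1)) * (1 - p ^ (2 * N + 2)) := by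
        rw [show 2 * (N + 1) = 2 * N + 1 + 1 by ring, eulerProd, Finset.prod_range_succ,
          Finset.prod_range_succ, ← eulerProd]
      rw [e5, e3, e4, e1, e2, show (N : ℤ) + (j + 1) = N + 1 + j by ring,
        show (N : ℤ) - (j - 1) = N + 1 - j by ring, ← hr, ← hq, hu j, hu1]
      push_cast
      rw [← hr, ← hq]
      simp only [zpow_add₀ hp, zpow_sub₀ hp, zpow_natCast, zpow_one]
      have hpj : p ^ j ≠ 0 := zpow_ne_zero _ hp
      field_simp
      ring
    · rw [Finset.prod_range_succ]
      generalize ∏ k ∈ Finset.range N, ((1 - p ^ k * x) * (1 - p ^ (k + 1) / x)) = P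
      field_simp
      ring

lemma summable_norm_pow_succ (hp1 : ‖p‖ < 1) (c : ℂ) :
    Summable fun k : ℕ => ‖-(p ^ (k + 1) * c)‖ := by
  have := ((summable_geometric_of_lt_one (norm_nonneg p) hp1).mul_right ‖p * c‖)
  refine this.congr fun k => ?_
  rw [norm_neg, ← norm_pow, ← norm_mul]
  congr 1
  ring

lemma tendsto_eulerProd (hp1 : ‖p‖ < 1) :
    ∃ e : ℂ, e ≠ 0 ∧ Tendsto (eulerProd p) atTop (𝓝 e) := by
  have hs : Summable fun k : ℕ => ‖-p ^ (k + 1)‖ := by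
    simpa using summable_norm_pow_succ hp1 1
  refine ⟨∏' k : ℕ, (1 + -p ^ (k + 1)), ?_, ?_⟩
  · refine tprod_one_add_ne_zero_of_summable (fun k => ?_) hs
    rw [← sub_eq_add_neg]
    exact one_sub_pow_succ_ne_zero hp1 k
  · refine (multipliable_one_add_of_summable hs).tendsto_prod_tprod_nat.congr fun N => ?_
    simp [eulerProd, sub_eq_add_neg]

lemma tendsto_prod_ellTheta (hp1 : ‖p‖ < 1) (x : ℂ) :
    Tendsto (fun N => ∏ k ∈ Finset.range N, ((1 - p ^ k * x) * (1 - p ^ (k + 1) / x))) atTop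
      (𝓝 (ellTheta x p)) := by
  refine Multipliable.tendsto_prod_tprod_nat (Multipliable.mul ?_ ?_)
  · simp only [sub_eq_add_neg]
    refine multipliable_one_add_of_summable ((summable_nat_add_iff 1).1 ?_)
    exact summable_norm_pow_succ hp1 x
  · simp only [sub_eq_add_neg, div_eq_mul_inv]
    exact multipliable_one_add_of_summable (summable_norm_pow_succ hp1 x⁻¹)

/-- The Jacobi triple product identity, up to the value of the constant factor. -/
lemma exists_ellTheta_mul_eq_tsum (hp : p ≠ 0) (hp1 : ‖p‖ < 1) :
    ∃ e : ℂ, e ≠ 0 ∧ ∀ (x : ℂ) (u : ℤ → ℂ), x ≠ 0 → u 0 = 1 →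
      (∀ j, u (j + 1) = -x * p ^ j * u j) → Summable (fun j => ‖u j‖) →
      ellTheta x p * e = ∑' j, u j := by
  obtain ⟨e, he, hlim⟩ := tendsto_eulerProd hp1
  refine ⟨e, he, fun x u hx hu0 hu hsum => ?_⟩
  obtain ⟨C, hC⟩ := hlim.norm.bddAbove_range
  obtain ⟨D, hD⟩ := (hlim.inv₀ he).norm.bddAbove_range
  have hC' : ∀ m, ‖eulerProd p m‖ ≤ C := fun m => hC ⟨m, rfl⟩
  have hD0 : 0 ≤ D := (norm_nonneg _).trans (hD ⟨0, rfl⟩)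
  have hD' : ∀ m, ‖eulerProdInv p m‖ ≤ D := by
    intro m
    unfold eulerProdInv
    split_ifs
    · rwa [norm_zero]
    · exact hD ⟨m.toNat, rfl⟩
  have hinv : Tendsto (eulerProdInv p) atTop (𝓝 e⁻¹) := by
    have h1 : Tendsto Int.toNat atTop atTop :=
      tendsto_atTop.2 fun b => (eventually_ge_atTop (b : ℤ)).mono fun m hm => by omega
    refine ((hlim.inv₀ he).comp h1).congr' ?_
    filter_upwards [eventually_ge_atTop 0] with m hm
    rw [eulerProdInv, if_neg (by omega)]
    rfl
  have hfin := hasSum_finite_triple_product hp hp1 hx hu0 hu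
  have hmain : Tendsto (fun N : ℕ => ∑' j : ℤ, eulerProd p (2 * N) * eulerProdInv p (N + j) *
        eulerProdInv p (N - j) * u j) atTop (𝓝 (∑' j, e * e⁻¹ * e⁻¹ * u j)) := by
    refine tendsto_tsum_of_dominated_convergence (hsum.mul_left (C * D * D)) (fun j => ?_)
      (Eventually.of_forall fun N j => ?_)
    · refine Tendsto.mul_const _ (Tendsto.mul (Tendsto.mul ?_ ?_) ?_)
      · exact hlim.comp (tendsto_id.const_mul_atTop' (by norm_num))
      · exact hinv.comp (tendsto_atTop_add_const_right _ j tendsto_natCast_atTop_atTop)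
      · exact hinv.comp (tendsto_atTop_add_const_right _ (-j) tendsto_natCast_atTop_atTop)
    · rw [norm_mul, norm_mul, norm_mul]
      have := hC' 0
      gcongr
      · exact mul_nonneg ((norm_nonneg _).trans this) hD0
      · exact (norm_nonneg _).trans this
      · exact hC' _
      · exact hD' _
      · exact hD' _
  have heq := tendsto_nhds_unique (tendsto_prod_ellTheta hp1 x)
    (hmain.congr fun N => (hfin N).tsum_eq)
  rw [heq, tsum_mul_left]
  field_simp

end TripleProduct

section ThetaIdentities

open Complex

lemma hasSum_mul_prod {f g : ℤ → ℂ} {a b : ℂ} (hf : HasSum f a) (hg : HasSum g b) :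
    HasSum (fun k : ℤ × ℤ => f k.1 * g k.2) (a * b) :=
  hf.mul hg (summable_mul_of_summable_norm hf.summable.norm hg.summable.norm)

lemma hasSum_jacobiTheta₂_mul (z w : ℂ) {τ : ℂ} (hτ : 0 < τ.im) :
    HasSum (fun k : ℤ × ℤ => jacobiTheta₂_term k.1 z τ * jacobiTheta₂_term k.2 w τ)
      (jacobiTheta₂ z τ * jacobiTheta₂ w τ) :=
  hasSum_mul_prod (f := fun k => jacobiTheta₂_term k z τ) (g := fun k => jacobiTheta₂_term k w τ)
    (hasSum_jacobiTheta₂_term z hτ) (hasSum_jacobiTheta₂_term w hτ)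

/-- Splitting a sum over `ℤ × ℤ` according to the parity of the sum of the coordinates. -/
lemma hasSum_parity_split {F : ℤ × ℤ → ℂ} {A B C : ℂ} (hA : HasSum F A)
    (hB : HasSum (fun k : ℤ × ℤ => F (k.1 + k.2, k.1 - k.2)) B)
    (hC : HasSum (fun k : ℤ × ℤ => F (k.1 + k.2 + 1, k.1 - k.2)) C) : A = B + C := by
  let g₀ : ℤ × ℤ → ℤ × ℤ := fun k => (k.1 + k.2, k.1 - k.2)
  let g₁ : ℤ × ℤ → ℤ × ℤ := fun k => (k.1 + k.2 + 1, k.1 - k.2)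
  have hg₀ : g₀.Injective := by
    rintro ⟨a, b⟩ ⟨c, d⟩ h
    simp only [g₀, Prod.mk.injEq] at h ⊢
    omega
  have hg₁ : g₁.Injective := by
    rintro ⟨a, b⟩ ⟨c, d⟩ h
    simp only [g₁, Prod.mk.injEq] at h ⊢
    omega
  have hc : IsCompl (Set.range g₀) (Set.range g₁) := by
    constructor
    · rw [Set.disjoint_left]
      rintro _ ⟨⟨a, b⟩, rfl⟩ ⟨⟨c, d⟩, h⟩
      simp only [g₀, g₁, Prod.mk.injEq] at h
      omega
    · rw [codisjoint_iff, Set.top_eq_univ, Set.eq_univ_iff_forall]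
      rintro ⟨a, b⟩
      rcases Int.even_or_odd (a + b) with ⟨c, hc⟩ | ⟨c, hc⟩
      · exact Or.inl ⟨(c, a - c), by simp only [g₀, Prod.mk.injEq]; omega⟩
      · exact Or.inr ⟨(c, a - c - 1), by simp only [g₁, Prod.mk.injEq]; omega⟩
  exact hA.unique (HasSum.add_isCompl hc (hg₀.hasSum_range_iff.2 hB) (hg₁.hasSum_range_iff.2 hC))

/-- The addition formula expressing a product of theta functions through theta functions with
period `2 * τ`. -/
lemma jacobiTheta₂_add_mul_sub (z w : ℂ) {τ : ℂ} (hτ : 0 < τ.im) :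
    jacobiTheta₂ (z + w) τ * jacobiTheta₂ (z - w) τ =
      jacobiTheta₂ (2 * z) (2 * τ) * jacobiTheta₂ (2 * w) (2 * τ) +
      cexp (2 * π * I * (z + w) + π * I * τ) *
        (jacobiTheta₂ (2 * z + τ) (2 * τ) * jacobiTheta₂ (2 * w + τ) (2 * τ)) := by
  have hτ2 : 0 < (2 * τ).im := by simpa using hτ
  refine hasSum_parity_split (hasSum_jacobiTheta₂_mul (z + w) (z - w) hτ)
    ((hasSum_jacobiTheta₂_mul (2 * z) (2 * w) hτ2).congr_fun fun k => ?_)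
    (((hasSum_jacobiTheta₂_mul (2 * z + τ) (2 * w + τ) hτ2).mul_left _).congr_fun fun k => ?_)
  all_goals
    simp only [jacobiTheta₂_term, ← Complex.exp_add]
    congr 1
    push_cast
    ring

lemma exists_exp_eq_nome {p : ℂ} (hp : p ≠ 0) (hp1 : ‖p‖ < 1) :
    ∃ τ : ℂ, 0 < τ.im ∧ p = cexp (2 * π * I * τ) := by
  refine ⟨log p / (2 * π * I), ?_, ?_⟩
  · rw [show log p / (2 * π * I) = -(log p * I) * ((2 * π)⁻¹ : ℝ) by
      push_cast; field_simp; simp, im_mul_ofReal]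
    simp only [neg_im, mul_I_im, log_re]
    have := Real.log_neg (norm_pos_iff.2 hp) hp1
    have := Real.pi_pos
    exact mul_pos (by linarith) (by positivity)
  · rw [mul_div_cancel₀ _ Complex.two_pi_I_ne_zero, exp_log hp]

/-- The theta function in additive notation, normalized to be odd. -/
noncomputable def oddTheta (p a : ℂ) : ℂ := cexp (-a / 2) * ellTheta (cexp a) p

lemma ellTheta_exp (p a : ℂ) : ellTheta (cexp a) p = cexp (a / 2) * oddTheta p a := by
  rw [oddTheta, ← mul_assoc, ← Complex.exp_add, neg_div, add_neg_cancel, Complex.exp_zero, one_mul]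

lemma exists_oddTheta_eq_jacobiTheta₂ {p τ : ℂ} (hτ : 0 < τ.im) (hpτ : p = cexp (2 * π * I * τ))
    (hp1 : ‖p‖ < 1) : ∃ c : ℂ, ∀ a,
      oddTheta p a = c * cexp (-a / 2) * jacobiTheta₂ (a / (2 * π * I) + (1 - τ) / 2) τ := by
  obtain ⟨e, he, h⟩ := exists_ellTheta_mul_eq_tsum (hpτ ▸ Complex.exp_ne_zero _) hp1
  refine ⟨e⁻¹, fun a => ?_⟩
  have := h (cexp a) (fun j => jacobiTheta₂_term j (a / (2 * π * I) + (1 - τ) / 2) τ)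
    (Complex.exp_ne_zero _) (by simp [jacobiTheta₂_term]) (fun j => ?_)
    ((summable_jacobiTheta₂_term_iff _ τ).2 hτ).norm
  · rw [oddTheta, jacobiTheta₂, ← this]
    field_simp
  · rw [hpτ, ← Complex.exp_int_mul, ← neg_one_mul, ← Complex.exp_pi_mul_I]
    simp only [jacobiTheta₂_term, ← Complex.exp_add]
    congr 1
    push_cast
    field_simp
    ring

lemma oddTheta_neg {p : ℂ} (hp : p ≠ 0) (hp1 : ‖p‖ < 1) (a : ℂ) :
    oddTheta p (-a) = -oddTheta p a := by
  obtain ⟨τ, hτ, hpτ⟩ := exists_exp_eq_nome hp hp1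
  obtain ⟨c, hc⟩ := exists_oddTheta_eq_jacobiTheta₂ hτ hpτ hp1
  have h1 := jacobiTheta₂_add_left (a / (2 * π * I) + (-1 - τ) / 2) τ
  have h2 := jacobiTheta₂_add_left' (a / (2 * π * I) + (-1 - τ) / 2) τ
  have h3 : cexp (-(-a) / 2) * cexp (-π * I * (τ + 2 * (a / (2 * π * I) + (-1 - τ) / 2))) =
      -cexp (-a / 2) := by
    rw [← Complex.exp_add, show -(-a) / 2 + -π * I * (τ + 2 * (a / (2 * π * I) + (-1 - τ) / 2)) =
      -a / 2 + π * I by field_simp; ring, Complex.exp_add, Complex.exp_pi_mul_I, mul_neg_one]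
  rw [hc, hc, ← jacobiTheta₂_neg_left, show -(-a / (2 * π * I) + (1 - τ) / 2) =
      a / (2 * π * I) + (-1 - τ) / 2 + τ by ring,
    show a / (2 * π * I) + (1 - τ) / 2 = a / (2 * π * I) + (-1 - τ) / 2 + 1 by ring, h1, h2]
  linear_combination c * jacobiTheta₂ (a / (2 * π * I) + (-1 - τ) / 2) τ * h3

lemma differentiable_oddTheta {p : ℂ} (hp : p ≠ 0) (hp1 : ‖p‖ < 1) :
    Differentiable ℂ (oddTheta p) := by
  obtain ⟨τ, hτ, hpτ⟩ := exists_exp_eq_nome hp hp1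
  obtain ⟨c, hc⟩ := exists_oddTheta_eq_jacobiTheta₂ hτ hpτ hp1
  rw [funext hc]
  refine Differentiable.mul (by fun_prop) fun a => ?_
  exact DifferentiableAt.comp a (differentiableAt_jacobiTheta₂_fst _ hτ) (by fun_prop)

lemma exists_oddTheta_add_mul_sub {p : ℂ} (hp : p ≠ 0) (hp1 : ‖p‖ < 1) :
    ∃ A₀ A₁ B₀ B₁ : ℂ → ℂ, ∀ a b, oddTheta p (a + b) * oddTheta p (a - b) =
      A₀ a * B₀ b + A₁ a * B₁ b := by
  obtain ⟨τ, hτ, hpτ⟩ := exists_exp_eq_nome hp hp1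
  obtain ⟨c, hc⟩ := exists_oddTheta_eq_jacobiTheta₂ hτ hpτ hp1
  let ζ : ℂ → ℂ := fun a => a / (2 * π * I) + (1 - τ) / 2
  let η : ℂ → ℂ := fun b => b / (2 * π * I)
  refine ⟨fun a => c ^ 2 * cexp (-a) * jacobiTheta₂ (2 * ζ a) (2 * τ),
    fun a => c ^ 2 * cexp (-a) * (cexp (2 * π * I * ζ a + π * I * τ) *
      jacobiTheta₂ (2 * ζ a + τ) (2 * τ)),
    fun b => jacobiTheta₂ (2 * η b) (2 * τ),
    fun b => cexp (2 * π * I * η b) * jacobiTheta₂ (2 * η b + τ) (2 * τ), fun a b => ?_⟩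
  have key := jacobiTheta₂_add_mul_sub (ζ a) (η b) hτ
  have e1 : cexp (-(a + b) / 2) * cexp (-(a - b) / 2) = cexp (-a) := by
    rw [← Complex.exp_add]; congr 1; ring
  have e2 : cexp (2 * π * I * (ζ a + η b) + π * I * τ) =
      cexp (2 * π * I * ζ a + π * I * τ) * cexp (2 * π * I * η b) := by
    rw [← Complex.exp_add]; congr 1; ring
  rw [hc, hc, show (a + b) / (2 * π * I) + (1 - τ) / 2 = ζ a + η b by simp only [ζ, η]; ring,
    show (a - b) / (2 * π * I) + (1 - τ) / 2 = ζ a - η b by simp only [ζ, η]; ring]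
  beta_reduce
  rw [← e1]
  rw [e2] at key
  linear_combination c ^ 2 * (cexp (-(a + b) / 2) * cexp (-(a - b) / 2)) * key

end ThetaIdentities

section Signs

/-- The sign attached to a Boolean. -/
def boolSign (b : Bool) : ℂ := if b = false then -1 else 1

lemma pw_exp (a : ℂ) (b : Bool) : pw (Complex.exp a) b = Complex.exp (boolSign b * a) := by
  cases b <;> simp [pw, boolSign, Complex.exp_neg]

lemma prod_boolSign {ι : Type*} [Fintype ι] (σ : ι → Bool) :
    ∏ i, boolSign (σ i) = (-1) ^ (Finset.univ.filter fun i => σ i = false).card := by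
  simp [boolSign, Finset.prod_ite]

lemma bijective_filter_eq_false {ι : Type*} [Fintype ι] [DecidableEq ι] :
    Function.Bijective fun σ : ι → Bool => Finset.univ.filter fun i => σ i = false := by
  refine ⟨fun σ σ' h => funext fun i => ?_, fun T => ⟨fun i => decide (i ∉ T), ?_⟩⟩
  · have := congrArg (i ∈ ·) h
    simp only [Finset.mem_filter, Finset.mem_univ, true_and, eq_iff_iff] at this
    cases h1 : σ i <;> cases h2 : σ' i <;> simp_all
  · ext i
    simp

variable {p : ℂ}

lemma ellTheta_single_factor (hodd : ∀ a, oddTheta p (-a) = -oddTheta p a) (ν ω κ ζ : ℂ)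
    (b : Bool) :
    ellTheta (Complex.exp ν * Complex.exp κ * pw (Complex.exp ζ) b) p *
        ellTheta (Complex.exp ω * Complex.exp κ * pw (Complex.exp ζ) b) p /
        ellTheta (pw (Complex.exp ζ) b ^ 2) p =
      Complex.exp ((ν + ω) / 2 + κ) / oddTheta p (2 * ζ) * (boolSign b *
        (oddTheta p (ν + (κ + boolSign b * ζ)) * oddTheta p (ω + (κ + boolSign b * ζ)))) := by
  have hsign : oddTheta p (2 * (boolSign b * ζ)) = boolSign b * oddTheta p (2 * ζ) := by
    cases b <;> simp [boolSign, hodd]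
  have hinv : (boolSign b)⁻¹ = boolSign b := by
    cases b <;> norm_num [boolSign]
  have hexp : Complex.exp ((ν + (κ + boolSign b * ζ)) / 2) *
      Complex.exp ((ω + (κ + boolSign b * ζ)) / 2) * (Complex.exp (boolSign b * ζ))⁻¹ =
        Complex.exp ((ν + ω) / 2 + κ) := by
    rw [← Complex.exp_neg, ← Complex.exp_add, ← Complex.exp_add]
    congr 1
    ring
  rw [pw_exp, ← Complex.exp_add, ← Complex.exp_add, ← Complex.exp_add, ← Complex.exp_add, add_assoc,
    add_assoc, ← Complex.exp_nat_mul, Nat.cast_ofNat, ellTheta_exp, ellTheta_exp, ellTheta_exp,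
    mul_div_cancel_left₀ _ two_ne_zero, hsign, div_eq_mul_inv, mul_inv, mul_inv, hinv, ← hexp]
  ring

lemma ellTheta_pair_factor (hodd : ∀ a, oddTheta p (-a) = -oddTheta p a) (κ κ' ζ ζ' : ℂ)
    (b b' : Bool) :
    (Complex.exp κ')⁻¹ * (ellTheta (Complex.exp κ * Complex.exp κ' *
        (pw (Complex.exp ζ) b * pw (Complex.exp ζ') b')) p *
        ellTheta (Complex.exp κ' * pw (Complex.exp ζ) b /
          (Complex.exp κ * pw (Complex.exp ζ') b')) p) /
        (ellTheta (pw (Complex.exp ζ) b * pw (Complex.exp ζ') b') p *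
          ellTheta (pw (Complex.exp ζ) b / pw (Complex.exp ζ') b') p) =
      (oddTheta p (ζ + ζ') * oddTheta p (ζ - ζ'))⁻¹ *
        (oddTheta p ((κ + boolSign b * ζ) + (κ' + boolSign b' * ζ')) *
          oddTheta p ((κ' - boolSign b' * ζ') - (κ - boolSign b * ζ))) := by
  have hsign : oddTheta p (boolSign b * ζ + boolSign b' * ζ') *
      oddTheta p (boolSign b * ζ - boolSign b' * ζ') =
        oddTheta p (ζ + ζ') * oddTheta p (ζ - ζ') := by
    have h2 : oddTheta p (-ζ + ζ') = -oddTheta p (ζ - ζ') := by rw [← hodd]; congr 1; ring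
    have h3 : oddTheta p (-ζ - ζ') = -oddTheta p (ζ + ζ') := by rw [← hodd]; congr 1; ring
    cases b <;> cases b' <;>
      simp [boolSign, h2, h3, ← sub_eq_add_neg, mul_comm (oddTheta p (ζ - ζ'))]
  rw [pw_exp, pw_exp, ← hsign]
  generalize boolSign b * ζ = A
  generalize boolSign b' * ζ' = B
  have hexp : Complex.exp (-κ') * Complex.exp ((κ + A + (κ' + B)) / 2) *
      Complex.exp ((κ' - B - (κ - A)) / 2) =
        Complex.exp ((A + B) / 2) * Complex.exp ((A - B) / 2) := by
    rw [← Complex.exp_add, ← Complex.exp_add, ← Complex.exp_add]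
    congr 1
    ring
  rw [← Complex.exp_neg, ← Complex.exp_add, ← Complex.exp_add, ← Complex.exp_add,
    ← Complex.exp_add, ← Complex.exp_add, ← Complex.exp_sub, ← Complex.exp_sub,
    show κ + κ' + (A + B) = κ + A + (κ' + B) by ring,
    show κ' + A - (κ + B) = κ' - B - (κ - A) by ring, ellTheta_exp, ellTheta_exp, ellTheta_exp,
    ellTheta_exp]
  have h1 := Complex.exp_ne_zero ((A + B) / 2)
  have h2 := Complex.exp_ne_zero ((A - B) / 2)
  calc _ = Complex.exp (-κ') * Complex.exp ((κ + A + (κ' + B)) / 2) *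
        Complex.exp ((κ' - B - (κ - A)) / 2) / (Complex.exp ((A + B) / 2) *
          Complex.exp ((A - B) / 2)) * ((oddTheta p (A + B) * oddTheta p (A - B))⁻¹ *
        (oddTheta p (κ + A + (κ' + B)) * oddTheta p (κ' - B - (κ - A)))) := by
        simp only [div_eq_mul_inv, mul_inv]; ring
    _ = _ := by rw [hexp, div_self (mul_ne_zero h1 h2), one_mul]

end Signs

/-- The vanishing theorem with all parameters written as exponentials. -/
lemma sum_ellTheta_exp_eq_zero {n : ℕ} (hn : 1 ≤ n) {p : ℂ} (hp : p ≠ 0) (hp1 : ‖p‖ < 1)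
    (ν ω : ℂ) (κ ζ : Fin n → ℂ) (hbal : ν + ω + ∑ i, 2 * κ i = 0) :
    (∑ σ : Fin n → Bool,
      (∏ i, ellTheta (Complex.exp ν * Complex.exp (κ i) * pw (Complex.exp (ζ i)) (σ i)) p *
        ellTheta (Complex.exp ω * Complex.exp (κ i) * pw (Complex.exp (ζ i)) (σ i)) p /
        ellTheta (pw (Complex.exp (ζ i)) (σ i) ^ 2) p) *
      ∏ i, ∏ j, if i < j then
        (Complex.exp (κ j))⁻¹ * (ellTheta (Complex.exp (κ i) * Complex.exp (κ j) *
            (pw (Complex.exp (ζ i)) (σ i) * pw (Complex.exp (ζ j)) (σ j))) p *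
          ellTheta (Complex.exp (κ j) * pw (Complex.exp (ζ i)) (σ i) /
            (Complex.exp (κ i) * pw (Complex.exp (ζ j)) (σ j))) p) /
          (ellTheta (pw (Complex.exp (ζ i)) (σ i) * pw (Complex.exp (ζ j)) (σ j)) p *
            ellTheta (pw (Complex.exp (ζ i)) (σ i) / pw (Complex.exp (ζ j)) (σ j)) p)
      else 1) = 0 := by
  have hodd := oddTheta_neg hp hp1
  obtain ⟨A₀, A₁, B₀, B₁, hrank⟩ := exists_oddTheta_add_mul_sub hp hp1
  have hzero := signedSum_eq_zero hodd hrank (differentiable_oddTheta hp hp1) (n - 1) Finset.univ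
    (by simp; omega) (fun i => κ i + ζ i) (fun i => κ i - ζ i) ν ω
    (by rw [← hbal]; congr 1; exact Finset.sum_congr rfl fun i _ => by ring)
  rw [signedSum, Finset.powerset_univ] at hzero
  rw [← mul_zero ((∏ i, Complex.exp ((ν + ω) / 2 + κ i) / oddTheta p (2 * ζ i)) *
    ∏ i, ∏ j, if i < j then (oddTheta p (ζ i + ζ j) * oddTheta p (ζ i - ζ j))⁻¹ else 1),
    ← hzero, ← bijective_filter_eq_false.sum_comp, Finset.mul_sum]
  refine Finset.sum_congr rfl fun σ _ => ?_
  have hX : ∀ i, swapOn (fun i => κ i + ζ i) (fun i => κ i - ζ i)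
      (Finset.univ.filter fun i => σ i = false) i = κ i + boolSign (σ i) * ζ i := by
    intro i
    cases h : σ i <;> simp [swapOn, boolSign, h, sub_eq_add_neg]
  have hY : ∀ i, swapOn (fun i => κ i - ζ i) (fun i => κ i + ζ i)
      (Finset.univ.filter fun i => σ i = false) i = κ i - boolSign (σ i) * ζ i := by
    intro i
    cases h : σ i <;> simp [swapOn, boolSign, h]
  simp only [ellTheta_single_factor hodd, ellTheta_pair_factor hodd, pairProd, hX, hY]
  rw [← prod_boolSign, Finset.prod_mul_distrib, Finset.prod_mul_distrib]
  have hpair : ∀ f g : Fin n → Fin n → ℂ, (∏ i, ∏ j, if i < j then f i j * g i j else 1) =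
      (∏ i, ∏ j, if i < j then f i j else 1) * ∏ i, ∏ j, if i < j then g i j else 1 := by
    intro f g
    simp only [← Finset.prod_mul_distrib]
    refine Finset.prod_congr rfl fun i _ => Finset.prod_congr rfl fun j _ => ?_
    split_ifs <;> simp
  rw [hpair]
  ring

/-- Lemma (vanishing of a symmetrized theta sum, "Lemma vanishI"). -/
theorem vanishI (n : ℕ) (hn : 1 ≤ n) (p : ℂ)
    (hp0 : 0 < ‖p‖) (hp1 : ‖p‖ < 1)
    (v w : ℂ) (qq z : Fin n → ℂ)
    (hv0 : v ≠ 0) (hw0 : w ≠ 0) (hq0 : ∀ i, qq i ≠ 0) (hz0 : ∀ i, z i ≠ 0)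
    (hbal : v * w * ∏ i, qq i ^ 2 = 1)
    (hz2 : ∀ i, ellTheta (z i ^ 2) p ≠ 0)
    (hzij : ∀ i j, i < j → ellTheta (z i * z j) p ≠ 0 ∧ ellTheta (z i / z j) p ≠ 0) :
    (∑ σ : Fin n → Bool,
      (∏ i, ellTheta (v * qq i * pw (z i) (σ i)) p * ellTheta (w * qq i * pw (z i) (σ i)) p /
        ellTheta (pw (z i) (σ i) ^ 2) p) *
      ∏ i, ∏ j, if i < j then
        (qq j)⁻¹ * (ellTheta (qq i * qq j * (pw (z i) (σ i) * pw (z j) (σ j))) p *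
          ellTheta (qq j * pw (z i) (σ i) / (qq i * pw (z j) (σ j))) p) /
          (ellTheta (pw (z i) (σ i) * pw (z j) (σ j)) p *
            ellTheta (pw (z i) (σ i) / pw (z j) (σ j)) p)
      else 1) = 0 := by
  have hp : p ≠ 0 := norm_pos_iff.1 hp0
  obtain ⟨ν, rfl⟩ : ∃ ν, Complex.exp ν = v := ⟨_, Complex.exp_log hv0⟩
  obtain ⟨κ, rfl⟩ : ∃ κ : Fin n → ℂ, (fun i => Complex.exp (κ i)) = qq :=
    ⟨_, funext fun i => Complex.exp_log (hq0 i)⟩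
  obtain ⟨ζ, rfl⟩ : ∃ ζ : Fin n → ℂ, (fun i => Complex.exp (ζ i)) = z :=
    ⟨_, funext fun i => Complex.exp_log (hz0 i)⟩
  obtain rfl : w = Complex.exp (-ν - ∑ i, 2 * κ i) := by
    have h : ∏ i, Complex.exp (κ i) ^ 2 = Complex.exp (∑ i, 2 * κ i) := by
      simp only [Complex.exp_sum, ← Complex.exp_nat_mul, Nat.cast_ofNat]
    rw [h] at hbal
    rw [sub_eq_add_neg, Complex.exp_add, Complex.exp_neg, Complex.exp_neg]
    have h1 := Complex.exp_ne_zero ν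
    have h2 := Complex.exp_ne_zero (∑ i, 2 * κ i)
    field_simp
    linear_combination hbal
  exact sum_ellTheta_exp_eq_zero hn hp hp1 ν _ κ ζ (by ring)
end
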